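/- arXiv:1106.2333 — 5 statements merged into one kernel-verified Lean document; each statement's English description precedes it below -/
import Mathlib

section
/- Let p ≥ 1, let μ, β be vectors in ℝ^p, let A be an invertible p×p real matrix, let g be a nonnegative measurable function supported on (0,∞) with 0 < ∫₀^∞ g(x) dx < ∞, and define f(y) = |det A|^{-1} ∫₀^∞ (2πx)^{-p/2} · exp(−‖A⁻¹(y − μ − xβ)‖²/(2x)) · g(x) dx for y ∈ ℝ^p, assumed finite everywhere. If the function g*(x) = x^{−(p−1)/2} g(x) is log-convex on (0,∞), then for every nonzero vector b ∈ ℝ^p the function t ↦ f(μ + t·b) is log-convex on (0, ∞). -/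
open MeasureTheory Set Real


lemma aux_coef (r1 r2 : ℝ) (h1 : 0 < r1) (h2 : 0 < r2) (S : Set ℝ) (hS : S ⊆ Ioi 0)
    (hc : OrdConnected S) : ∃ a1 a2 s1 s2 : ℝ, ∀ s, 0 < s → s ≠ s1 → s ≠ s2 →
      (s ∈ S → a1 * exp (r1 * s) + a2 * exp (-r2 * s) ≤ 1) ∧
      (s ∉ S → 1 ≤ a1 * exp (r1 * s) + a2 * exp (-r2 * s)) := by
  rcases S.eq_empty_or_nonempty with rfl | hne
  · refine ⟨1, 0, 0, 0, fun s hs _ _ => ⟨fun h => h.elim, fun _ => ?_⟩⟩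
    have : 0 < r1 * s := by positivity
    have := Real.add_one_le_exp (r1 * s)
    linarith
  have hbb : BddBelow S := ⟨0, fun x hx => (hS hx).le⟩
  by_cases hba : BddAbove S
  swap
  · refine ⟨0, exp (r2 * sInf S), sInf S, sInf S, fun s hs hs1 _ => ⟨fun h => ?_, fun h => ?_⟩⟩
    · have := csInf_le hbb h
      rw [zero_mul, zero_add, ← exp_add, exp_le_one_iff]
      nlinarith
    · rw [zero_mul, zero_add, ← exp_add, one_le_exp_iff]
      by_contra hcon
      have hlt : sInf S < s := by
        by_contra h'
        push Not at h' hcon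
        nlinarith
      obtain ⟨u, hu, hus⟩ := (csInf_lt_iff hbb hne).1 hlt
      rw [not_bddAbove_iff] at hba
      obtain ⟨v, hv, hsv⟩ := hba s
      exact h (hc.out hu hv ⟨hus.le, hsv.le⟩)
  have hle : sInf S ≤ sSup S := csInf_le_csSup hne hbb hba
  rcases hle.eq_or_lt with heq | hlt
  · refine ⟨1, 0, sInf S, sInf S, fun s hs hs1 _ => ⟨fun h => ?_, fun _ => ?_⟩⟩
    · exact absurd (le_antisymm (heq ▸ le_csSup hba h) (csInf_le hbb h)) hs1
    have : 0 < r1 * s := by positivity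
    have := Real.add_one_le_exp (r1 * s)
    linarith
  set s1 := sInf S
  set s2 := sSup S
  have e1 : exp (r1 * s1) < exp (r1 * s2) := exp_lt_exp.2 (by nlinarith)
  have e2 : exp (-r2 * s2) < exp (-r2 * s1) := exp_lt_exp.2 (by nlinarith)
  have p1 := exp_pos (r1 * s1)
  have p2 := exp_pos (-r2 * s2)
  set D := exp (r1 * s2) * exp (-r2 * s1) - exp (r1 * s1) * exp (-r2 * s2) with hD
  have hDp : 0 < D := by
    rw [hD]; nlinarith
  set a1 := (exp (-r2 * s1) - exp (-r2 * s2)) / D with ha1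
  set a2 := (exp (r1 * s2) - exp (r1 * s1)) / D with ha2
  have a1p : 0 ≤ a1 := div_nonneg (by linarith) hDp.le
  have a2p : 0 ≤ a2 := div_nonneg (by linarith) hDp.le
  have v1 : a1 * exp (r1 * s1) + a2 * exp (-r2 * s1) = 1 := by
    rw [ha1, ha2, div_mul_eq_mul_div, div_mul_eq_mul_div, ← add_div,
      div_eq_one_iff_eq hDp.ne', hD]; ring
  have v2 : a1 * exp (r1 * s2) + a2 * exp (-r2 * s2) = 1 := by
    rw [ha1, ha2, div_mul_eq_mul_div, div_mul_eq_mul_div, ← add_div,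
      div_eq_one_iff_eq hDp.ne', hD]; ring
  have hcx : ConvexOn ℝ univ (fun s : ℝ => a1 * exp (r1 * s) + a2 * exp (-r2 * s)) := by
    have c (r : ℝ) : ConvexOn ℝ univ (fun s : ℝ => exp (r * s)) := by
      have := convexOn_exp.comp_linearMap (LinearMap.mul ℝ ℝ r)
      simpa [Function.comp_def] using this
    exact ((c r1).smul a1p).add ((c (-r2)).smul a2p)
  refine ⟨a1, a2, s1, s2, fun s hs n1 n2 => ⟨fun h => ?_, fun h => ?_⟩⟩
  · have := hcx.le_max_of_mem_Icc (mem_univ s1) (mem_univ s2) ⟨csInf_le hbb h, le_csSup hba h⟩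
    simpa [v1, v2, -neg_mul] using this
  · by_contra hcon
    push Not at hcon
    rcases lt_or_gt_of_ne n1 with l | l
    · have := hcx.slope_mono_adjacent (mem_univ s) (mem_univ s2) l hlt
      simp only [v1, v2] at this
      rw [sub_self, zero_div, div_le_iff₀ (by linarith)] at this
      linarith
    rcases lt_or_gt_of_ne n2 with l2 | l2
    · obtain ⟨u, hu, hus⟩ := (csInf_lt_iff hbb hne).1 l
      obtain ⟨v, hv, hsv⟩ := (lt_csSup_iff hba hne).1 l2
      exact h (hc.out hu hv ⟨hus.le, hsv.le⟩)
    · have := hcx.slope_mono_adjacent (mem_univ s1) (mem_univ s) hlt l2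
      simp only [v1, v2] at this
      rw [sub_self, zero_div, le_div_iff₀ (by linarith)] at this
      linarith


lemma aux_int (T l : ℝ) (hT : 0 < T) (hl : 0 < l) :
    IntegrableOn (fun x : ℝ => (√x)⁻¹ * exp (-(T ^ 2 / x)) * exp (-(l ^ 2 * x))) (Ioi 0) ∧
    ∫ x in Ioi (0:ℝ), (√x)⁻¹ * exp (-(T ^ 2 / x)) * exp (-(l ^ 2 * x)) =
      √π / l * exp (-(2 * l * T)) := by
  set w : ℝ → ℝ := fun x => l * √x - T * (√x)⁻¹ with hw
  set w' : ℝ → ℝ := fun x => l / 2 * (√x)⁻¹ + T / 2 * (x * √x)⁻¹ with hw'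
  have hder : ∀ x ∈ Ioi (0:ℝ), HasDerivWithinAt w (w' x) (Ioi 0) x := by
    intro x hx
    have hx : 0 < x := hx
    have hs : 0 < √x := sqrt_pos.2 hx
    have d := hasDerivAt_sqrt hx.ne'
    have := (d.const_mul l).sub ((d.inv hs.ne').const_mul T)
    refine (this.congr_deriv ?_).hasDerivWithinAt
    simp only [hw']
    have h2 : x = √x ^ 2 := (sq_sqrt hx.le).symm
    rw [← h2]
    field_simp
    ring
  have hinj : InjOn w (Ioi 0) := by
    apply StrictMonoOn.injOn
    intro x hx y hy hxy
    have hx : 0 < x := hx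
    have hs : 0 < √x := sqrt_pos.2 hx
    have h1 : √x < √y := sqrt_lt_sqrt hx.le hxy
    have h2 : (√y)⁻¹ < (√x)⁻¹ := by gcongr
    simp only [hw]
    nlinarith
  have himg : w '' Ioi 0 = univ := by
    apply eq_univ_of_forall
    intro v
    set r := √(v ^ 2 + 4 * l * T) with hr
    have hrr : r ^ 2 = v ^ 2 + 4 * l * T := sq_sqrt (by positivity)
    have hlT : 0 < l * T := by positivity
    have hr0 : 0 ≤ r := sqrt_nonneg _
    have hvr : 0 < v + r := by
      by_contra h
      push Not at h
      nlinarith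
    have hq : 0 < (v + r) / (2 * l) := by positivity
    refine ⟨((v + r) / (2 * l)) ^ 2, by simp only [mem_Ioi]; positivity, ?_⟩
    simp only [hw]
    rw [sqrt_sq hq.le]
    field_simp
    nlinarith
  have hmeas : MeasurableSet (Ioi (0:ℝ)) := measurableSet_Ioi
  have hwpos : ∀ x ∈ Ioi (0:ℝ), |w' x| = w' x := by
    intro x hx
    have hx : 0 < x := hx
    apply abs_of_nonneg
    simp only [hw']; positivity
  have hI := integral_image_eq_integral_abs_deriv_smul hmeas hder hinj (fun v => exp (-1 * v ^ 2))
  have hi := (integrableOn_image_iff_integrableOn_abs_deriv_smul hmeas hder hinj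
    (fun v => exp (-1 * v ^ 2))).1
      (by rw [himg, integrableOn_univ]; exact integrable_exp_neg_mul_sq one_pos)
  rw [himg, Measure.restrict_univ, integral_gaussian, div_one] at hI
  set G : ℝ → ℝ := fun x => exp (-1 * w x ^ 2) with hG
  have hi2 : IntegrableOn (fun x => w' x * G x) (Ioi 0) := by
    refine hi.congr_fun (fun x hx => ?_) hmeas
    simp only [hwpos x hx, smul_eq_mul, hG]
  have hI2 : √π = ∫ x in Ioi (0:ℝ), w' x * G x := by
    rw [hI]
    refine setIntegral_congr_fun hmeas (fun x hx => ?_)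
    simp only [hwpos x hx, smul_eq_mul, hG]
  have hwm : Measurable w := by simp only [hw]; fun_prop
  have hGm : Measurable G := by simp only [hG]; fun_prop
  have hiA : IntegrableOn (fun x => (√x)⁻¹ * G x) (Ioi 0) := by
    refine Integrable.mono' (hi2.const_mul (2 / l)) (by fun_prop) ?_
    refine (ae_restrict_iff' hmeas).2 (ae_of_all _ fun x hx => ?_)
    have hx : 0 < x := hx
    have hg : 0 < G x := exp_pos _
    rw [norm_of_nonneg (by positivity), ← mul_assoc]
    gcongr
    simp only [hw']
    have : 2 / l * (l / 2 * (√x)⁻¹ + T / 2 * (x * √x)⁻¹) = (√x)⁻¹ + T / l * (x * √x)⁻¹ := by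
      field_simp
    rw [this]
    have : 0 ≤ T / l * (x * √x)⁻¹ := by positivity
    linarith
  have hiB : IntegrableOn (fun x => (x * √x)⁻¹ * G x) (Ioi 0) := by
    have := (hi2.sub (hiA.const_mul (l / 2))).const_mul (2 / T)
    refine IntegrableOn.congr_fun this (fun x hx => ?_) hmeas
    simp only [Pi.sub_apply, hw']
    field_simp
    ring
  have hsum : √π = l / 2 * (∫ x in Ioi (0:ℝ), (√x)⁻¹ * G x) +
      T / 2 * ∫ x in Ioi (0:ℝ), (x * √x)⁻¹ * G x := by
    rw [hI2, ← integral_const_mul, ← integral_const_mul,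
      ← integral_add (hiA.const_mul _) (hiB.const_mul _)]
    refine setIntegral_congr_fun hmeas (fun x hx => ?_)
    simp only [hw']; ring
  have hrefl : (∫ x in Ioi (0:ℝ), (√x)⁻¹ * G x) = T / l * ∫ x in Ioi (0:ℝ), (x * √x)⁻¹ * G x := by
    set c := (T / l) ^ 2 with hc
    have hcp : 0 < c := by positivity
    have dd : ∀ x ∈ Ioi (0:ℝ), HasDerivWithinAt (fun x => c * x⁻¹) (c * (-(x ^ 2)⁻¹)) (Ioi 0) x :=
      fun x hx => ((hasDerivAt_inv (ne_of_gt hx)).const_mul c).hasDerivWithinAt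
    have hj : InjOn (fun x => c * x⁻¹) (Ioi 0) := by
      intro x _ y _ h
      simpa [hcp.ne'] using h
    have hm : (fun x => c * x⁻¹) '' Ioi 0 = Ioi 0 := by
      ext y
      constructor
      · rintro ⟨x, hx, rfl⟩
        have hx : 0 < x := hx
        simp only [mem_Ioi]; positivity
      · intro hy
        have hy : 0 < y := hy
        refine ⟨c * y⁻¹, by simp only [mem_Ioi]; positivity, ?_⟩
        field_simp
    have := integral_image_eq_integral_abs_deriv_smul hmeas dd hj (fun x => (√x)⁻¹ * G x)
    rw [hm] at this
    rw [this, ← integral_const_mul]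
    refine setIntegral_congr_fun hmeas (fun x hx => ?_)
    have hx : 0 < x := hx
    have hs : 0 < √x := sqrt_pos.2 hx
    have hsq : √(c * x⁻¹) = T / l * (√x)⁻¹ := by
      rw [sqrt_mul hcp.le, hc, sqrt_sq (by positivity), sqrt_inv]
    have hGG : G (c * x⁻¹) = G x := by
      simp only [hG, hw, hsq]
      congr 2
      field_simp
      ring
    have h2 : x = √x ^ 2 := (sq_sqrt hx.le).symm
    simp only [hGG, hsq, smul_eq_mul, mul_neg, abs_neg]
    rw [abs_of_nonneg (by positivity), ← mul_assoc, ← mul_assoc]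
    congr 1
    rw [hc]
    field_simp
    exact h2.symm
  have hval : ∫ x in Ioi (0:ℝ), (√x)⁻¹ * G x = √π / l := by
    rw [hsum, hrefl]; field_simp; ring
  have hGe : ∀ x ∈ Ioi (0:ℝ), (√x)⁻¹ * G x * exp (-(2 * l * T)) =
      (√x)⁻¹ * exp (-(T ^ 2 / x)) * exp (-(l ^ 2 * x)) := by
    intro x hx
    have hx : 0 < x := hx
    have hs : 0 < √x := sqrt_pos.2 hx
    rw [mul_assoc ((√x)⁻¹), mul_assoc ((√x)⁻¹), ← exp_add, ← exp_add]
    congr 2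
    simp only [hw]
    have h2 : x = √x ^ 2 := (sq_sqrt hx.le).symm
    generalize √x = q at *
    subst h2
    field_simp
    ring
  refine ⟨IntegrableOn.congr_fun (hiA.mul_const _) hGe hmeas, ?_⟩
  rw [← hval, ← integral_mul_const]
  exact (setIntegral_congr_fun hmeas hGe).symm

lemma aux_pos (u : ℝ → ℝ) (hu : ∀ x ∈ Ioi (0:ℝ), 0 < u x) (hi : IntegrableOn u (Ioi 0)) :
    0 < ∫ x in Ioi (0:ℝ), u x := by
  rw [setIntegral_pos_iff_support_of_nonneg_ae
    ((ae_restrict_iff' measurableSet_Ioi).2 (ae_of_all _ fun x hx => (hu x hx).le)) hi]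
  have : Function.support u ∩ Ioi 0 = Ioi 0 :=
    inter_eq_right.2 fun x hx => (hu x hx).ne'
  rw [this]
  simp

lemma aux_core (h : ℝ → ℝ) (hpos : ∀ x ∈ Ioi (0:ℝ), 0 < h x)
    (hlc : ∀ x₁ ∈ Ioi (0:ℝ), ∀ x₂ ∈ Ioi (0:ℝ), ∀ θ ∈ Ioo (0:ℝ) 1,
      h (θ * x₁ + (1 - θ) * x₂) ≤ h x₁ ^ θ * h x₂ ^ (1 - θ))
    (H : ℝ → ℝ) (hH : ∀ t, H t = ∫ x in Ioi (0:ℝ), (√x)⁻¹ * exp (-(t ^ 2 / x)) * h x)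
    (hint : ∀ t, 0 < t →
      IntegrableOn (fun x => (√x)⁻¹ * exp (-(t ^ 2 / x)) * h x) (Ioi 0))
    (t1 t2 θ : ℝ) (ht1 : 0 < t1) (h12 : t1 < t2) (hθ : θ ∈ Ioo (0:ℝ) 1) :
    H (θ * t1 + (1 - θ) * t2) ≤ H t1 ^ θ * H t2 ^ (1 - θ) := by
  obtain ⟨hθ0, hθ1⟩ := hθ
  have ht2 : 0 < t2 := ht1.trans h12
  have hmeas : MeasurableSet (Ioi (0:ℝ)) := measurableSet_Ioi
  have kpos : ∀ t : ℝ, ∀ x ∈ Ioi (0:ℝ), 0 < (√x)⁻¹ * exp (-(t ^ 2 / x)) * h x := by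
    intro t x hx
    have := hpos x hx
    have hx : 0 < x := hx
    positivity
  have H1 : 0 < H t1 := by rw [hH]; exact aux_pos _ (kpos t1) (hint t1 ht1)
  have H2 : 0 < H t2 := by rw [hH]; exact aux_pos _ (kpos t2) (hint t2 ht2)
  have H21 : H t2 < H t1 := by
    rw [← sub_pos, hH, hH, ← integral_sub (hint t1 ht1) (hint t2 ht2)]
    apply aux_pos _ _ ((hint t1 ht1).sub (hint t2 ht2))
    intro x hx
    have hhx := hpos x hx
    have hx : 0 < x := hx
    have hs : 0 < (√x)⁻¹ := by positivity
    have : exp (-(t2 ^ 2 / x)) < exp (-(t1 ^ 2 / x)) := by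
      apply exp_lt_exp.2
      gcongr
    simp only [Pi.sub_apply]
    rw [sub_pos]
    gcongr
  set m := (log (H t1) - log (H t2)) / (t2 - t1) with hm
  have mpos : 0 < m := div_pos (sub_pos.2 (log_lt_log H2 H21)) (sub_pos.2 h12)
  set l := m / 2 with hl
  have lpos : 0 < l := by positivity
  set C := H t1 * exp (m * t1) * l / √π with hC
  have sqpi : 0 < √π := sqrt_pos.2 pi_pos
  have Cpos : 0 < C := by positivity
  set F : ℝ → ℝ := fun t => H t1 * exp (m * t1) * exp (-(m * t)) with hF
  have iE : ∀ t, 0 < t → IntegrableOn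
      (fun x : ℝ => (√x)⁻¹ * exp (-(t ^ 2 / x)) * (C * exp (-(l ^ 2 * x)))) (Ioi 0) := by
    intro t ht
    refine IntegrableOn.congr_fun ((aux_int t l ht lpos).1.const_mul C) (fun x hx => ?_) hmeas
    ring
  have vE : ∀ t, 0 < t → ∫ x in Ioi (0:ℝ),
      (√x)⁻¹ * exp (-(t ^ 2 / x)) * (C * exp (-(l ^ 2 * x))) = F t := by
    intro t ht
    have h1 : ∫ x in Ioi (0:ℝ), (√x)⁻¹ * exp (-(t ^ 2 / x)) * (C * exp (-(l ^ 2 * x))) =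
        C * ∫ x in Ioi (0:ℝ), (√x)⁻¹ * exp (-(t ^ 2 / x)) * exp (-(l ^ 2 * x)) := by
      rw [← integral_const_mul]
      refine setIntegral_congr_fun hmeas (fun x hx => ?_)
      ring
    rw [h1, (aux_int t l ht lpos).2, hC]
    have : 2 * l * t = m * t := by rw [hl]; ring
    rw [this]
    simp only [hF]
    field_simp
  have F1 : F t1 = H t1 := by
    simp only [hF]; rw [mul_assoc, ← exp_add]; simp
  have F2 : F t2 = H t2 := by
    simp only [hF]
    have : m * t1 + -(m * t2) = log (H t2) - log (H t1) := by
      have h0 : t2 - t1 ≠ 0 := (sub_pos.2 h12).ne'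
      rw [hm]; field_simp; ring
    rw [mul_assoc, ← exp_add, this, exp_sub, exp_log H1, exp_log H2]
    field_simp
  set t := θ * t1 + (1 - θ) * t2 with ht
  have htt1 : t1 < t := by rw [ht]; nlinarith
  have htt2 : t < t2 := by rw [ht]; nlinarith
  have htp : 0 < t := ht1.trans htt1
  have Ft : F t = H t1 ^ θ * H t2 ^ (1 - θ) := by
    rw [rpow_def_of_pos H1, rpow_def_of_pos H2, ← exp_add]
    simp only [hF]
    rw [mul_assoc, ← exp_add]
    nth_rewrite 1 [← exp_log H1]
    rw [← exp_add]
    congr 1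
    have h0 : t2 - t1 ≠ 0 := (sub_pos.2 h12).ne'
    have hmm : m * (t2 - t1) = log (H t1) - log (H t2) := by rw [hm]; field_simp
    rw [ht]
    linear_combination (θ - 1) * hmm
  rw [← Ft]
  -- sublevel set
  set J : Set ℝ := {x | 0 < x ∧ h x ≤ C * exp (-(l ^ 2 * x))} with hJ
  have Jconv : ∀ x ∈ J, ∀ y ∈ J, ∀ z, x < z → z < y → z ∈ J := by
    rintro x ⟨hx, hxJ⟩ y ⟨hy, hyJ⟩ z hxz hzy
    refine ⟨hx.trans hxz, ?_⟩
    have hyx : 0 < y - x := by linarith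
    set η := (y - z) / (y - x) with hη
    have hη0 : 0 < η := div_pos (by linarith) hyx
    have hη1 : η < 1 := (div_lt_one hyx).2 (by linarith)
    have hz : z = η * x + (1 - η) * y := by
      rw [hη]; field_simp; ring
    have h1η : 0 < 1 - η := by linarith
    calc h z ≤ h x ^ η * h y ^ (1 - η) := by
          have := hlc x hx y hy η ⟨hη0, hη1⟩
          rwa [← hz] at this
      _ ≤ (C * exp (-(l ^ 2 * x))) ^ η * (C * exp (-(l ^ 2 * y))) ^ (1 - η) := by
          have := hpos x hx
          have := hpos y hy
          gcongr
      _ = C * exp (-(l ^ 2 * z)) := by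
          have e (q : ℝ) : C * exp q = exp (log C + q) := by rw [exp_add, exp_log Cpos]
          rw [e, e, e, ← exp_mul, ← exp_mul, ← exp_add]
          congr 1
          rw [hz]; ring
  set S : Set ℝ := {s | 0 < s ∧ s⁻¹ ∈ J} with hS
  have Sord : OrdConnected S := by
    refine ⟨?_⟩
    rintro u ⟨hu, huJ⟩ v ⟨hv, hvJ⟩ s ⟨hus, hsv⟩
    have hs : 0 < s := hu.trans_le hus
    rcases hus.eq_or_lt with rfl | hus
    · exact ⟨hu, huJ⟩
    rcases hsv.eq_or_lt with rfl | hsv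
    · exact ⟨hv, hvJ⟩
    refine ⟨hs, Jconv _ hvJ _ huJ _ ?_ ?_⟩
    · gcongr
    · gcongr
  obtain ⟨a1, a2, s1, s2, hcoef⟩ := aux_coef (t ^ 2 - t1 ^ 2) (t2 ^ 2 - t ^ 2)
    (by nlinarith) (by nlinarith) S (fun s hs => hs.1) Sord
  have iD : ∀ t, 0 < t → IntegrableOn
      (fun x => (√x)⁻¹ * exp (-(t ^ 2 / x)) * (h x - C * exp (-(l ^ 2 * x)))) (Ioi 0) := by
    intro t ht
    refine IntegrableOn.congr_fun ((hint t ht).sub (iE t ht)) (fun x hx => ?_) hmeas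
    simp only [Pi.sub_apply]; ring
  have vD : ∀ t, 0 < t → ∫ x in Ioi (0:ℝ),
      (√x)⁻¹ * exp (-(t ^ 2 / x)) * (h x - C * exp (-(l ^ 2 * x))) = H t - F t := by
    intro t ht
    rw [← vE t ht, hH, ← integral_sub (hint t ht) (iE t ht)]
    refine setIntegral_congr_fun hmeas (fun x hx => ?_)
    ring
  have key : H t - F t ≤ a1 * (H t1 - F t1) + a2 * (H t2 - F t2) := by
    rw [← vD t htp, ← vD t1 ht1, ← vD t2 ht2, ← integral_const_mul, ← integral_const_mul,
      ← integral_add ((iD t1 ht1).const_mul a1) ((iD t2 ht2).const_mul a2)]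
    refine integral_mono_ae (iD t htp) (((iD t1 ht1).const_mul a1).add ((iD t2 ht2).const_mul a2)) ?_
    refine (ae_restrict_iff' hmeas).2 ?_
    have hfin : ∀ᵐ x : ℝ, x ∉ ({s1⁻¹, s2⁻¹} : Set ℝ) :=
      (Set.toFinite ({s1⁻¹, s2⁻¹} : Set ℝ)).countable.ae_notMem volume
    filter_upwards [hfin] with x hxn hx
    have hx : 0 < x := hx
    simp only [mem_insert_iff, mem_singleton_iff, not_or] at hxn
    obtain ⟨c1, c2⟩ := hcoef x⁻¹ (inv_pos.2 hx) (fun e => hxn.1 (by rw [← e, inv_inv]))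
      (fun e => hxn.2 (by rw [← e, inv_inv]))
    have e1 : exp (-(t1 ^ 2 / x)) = exp (-(t ^ 2 / x)) * exp ((t ^ 2 - t1 ^ 2) * x⁻¹) := by
      rw [← exp_add]; congr 1; field_simp; ring
    have e2 : exp (-(t2 ^ 2 / x)) = exp (-(t ^ 2 / x)) * exp (-(t2 ^ 2 - t ^ 2) * x⁻¹) := by
      rw [← exp_add]; congr 1; field_simp; ring
    rw [e1, e2]
    have kp : 0 < (√x)⁻¹ * exp (-(t ^ 2 / x)) := by positivity
    set E1 := exp ((t ^ 2 - t1 ^ 2) * x⁻¹)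
    set E2 := exp (-(t2 ^ 2 - t ^ 2) * x⁻¹)
    have fin : 0 ≤ (a1 * E1 + a2 * E2 - 1) * (h x - C * exp (-(l ^ 2 * x))) := by
      by_cases hxJ : h x ≤ C * exp (-(l ^ 2 * x))
      · have := c1 ⟨inv_pos.2 hx, by rw [inv_inv]; exact ⟨hx, hxJ⟩⟩
        exact mul_nonneg_of_nonpos_of_nonpos (by linarith) (by linarith)
      · have := c2 (fun hh => hxJ (by have := hh.2.2; rwa [inv_inv] at this))
        exact mul_nonneg (by linarith) (by linarith)
    have := mul_nonneg kp.le fin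
    linear_combination this
  rw [F1, F2] at key
  linarith

lemma aux_core' (h : ℝ → ℝ) (hpos : ∀ x ∈ Ioi (0:ℝ), 0 < h x)
    (hlc : ∀ x₁ ∈ Ioi (0:ℝ), ∀ x₂ ∈ Ioi (0:ℝ), ∀ θ ∈ Ioo (0:ℝ) 1,
      h (θ * x₁ + (1 - θ) * x₂) ≤ h x₁ ^ θ * h x₂ ^ (1 - θ))
    (H : ℝ → ℝ) (hH : ∀ t, H t = ∫ x in Ioi (0:ℝ), (√x)⁻¹ * exp (-(t ^ 2 / x)) * h x)
    (hint : ∀ t, 0 < t →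
      IntegrableOn (fun x => (√x)⁻¹ * exp (-(t ^ 2 / x)) * h x) (Ioi 0)) :
    (∀ t, 0 < t → 0 < H t) ∧ ∀ t1 t2 θ : ℝ, 0 < t1 → 0 < t2 → θ ∈ Ioo (0:ℝ) 1 →
    H (θ * t1 + (1 - θ) * t2) ≤ H t1 ^ θ * H t2 ^ (1 - θ) := by
  have hp : ∀ t, 0 < t → 0 < H t := by
    intro t ht
    rw [hH]
    refine aux_pos _ (fun x hx => ?_) (hint t ht)
    have := hpos x hx
    have hx : 0 < x := hx
    positivity
  refine ⟨hp, fun t1 t2 θ h1 h2 hθ => ?_⟩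
  rcases lt_trichotomy t1 t2 with h12 | rfl | h12
  · exact aux_core h hpos hlc H hH hint t1 t2 θ h1 h12 hθ
  · rw [← rpow_add (hp t1 h1)]
    have : θ * t1 + (1 - θ) * t1 = t1 := by ring
    rw [this]; simp
  · have := aux_core h hpos hlc H hH hint t2 t1 (1 - θ) h2 h12
      ⟨by linarith [hθ.2], by linarith [hθ.1]⟩
    rw [sub_sub_cancel] at this
    rw [add_comm, mul_comm (H t1 ^ θ)]
    exact this

/-- Theorem 2(iv): if `g*(x) = x^{-(p-1)/2} g(x)` is log-convex on `(0, ∞)`, then for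
every nonzero `b`, the function `t ↦ f(μ + t b)` is log-convex on `(0, ∞)`. -/
theorem multivariate_mixture_logConvex
    (p : ℕ) (hp : 1 ≤ p)
    (μ β : Fin p → ℝ)
    (A : Matrix (Fin p) (Fin p) ℝ) (hA : IsUnit A.det)
    (g : ℝ → ℝ) (hg_meas : Measurable g) (hg_nonneg : ∀ x, 0 ≤ g x)
    (hg_supp : ∀ x ≤ 0, g x = 0)
    (hg_int : IntegrableOn g (Ioi 0))
    (hg_pos : 0 < ∫ x in Ioi (0:ℝ), g x)
    (f : (Fin p → ℝ) → ℝ)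
    (hf : ∀ y, f y = |A.det|⁻¹ * ∫ x in Ioi (0:ℝ),
      (2 * π * x) ^ (-(p:ℝ)/2) *
        Real.exp (-(∑ i, (A⁻¹.mulVec (y - μ - x • β) i) ^ 2) / (2 * x)) * g x)
    (hf_int : ∀ y, IntegrableOn (fun x =>
      (2 * π * x) ^ (-(p:ℝ)/2) *
        Real.exp (-(∑ i, (A⁻¹.mulVec (y - μ - x • β) i) ^ 2) / (2 * x)) * g x) (Ioi 0))
    (hg_pos' : ∀ x ∈ Ioi (0:ℝ), 0 < x ^ (-((p:ℝ) - 1)/2) * g x)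
    (hg_lcx : ∀ x₁ ∈ Ioi (0:ℝ), ∀ x₂ ∈ Ioi (0:ℝ), ∀ θ ∈ Ioo (0:ℝ) 1,
      (θ * x₁ + (1 - θ) * x₂) ^ (-((p:ℝ) - 1)/2) * g (θ * x₁ + (1 - θ) * x₂) ≤
        (x₁ ^ (-((p:ℝ) - 1)/2) * g x₁) ^ θ * (x₂ ^ (-((p:ℝ) - 1)/2) * g x₂) ^ (1 - θ)) :
    ∀ b : Fin p → ℝ, b ≠ 0 →
      (∀ t ∈ Ioi (0:ℝ), 0 < f (μ + t • b)) ∧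
      (∀ t₁ ∈ Ioi (0:ℝ), ∀ t₂ ∈ Ioi (0:ℝ), ∀ θ ∈ Ioo (0:ℝ) 1,
        f (μ + (θ * t₁ + (1 - θ) * t₂) • b) ≤
          f (μ + t₁ • b) ^ θ * f (μ + t₂ • b) ^ (1 - θ)) := by
  intro b hb
  have hmeas : MeasurableSet (Ioi (0:ℝ)) := measurableSet_Ioi
  set a := A⁻¹.mulVec b with ha
  set c := A⁻¹.mulVec β with hc
  set α := ∑ i, a i ^ 2 with hα
  set δ := ∑ i, a i * c i with hδ
  set γ := ∑ i, c i ^ 2 with hγ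
  have hane : a ≠ 0 := by
    intro h0
    apply hb
    have h1 : A.mulVec (A⁻¹.mulVec b) = b := by
      rw [Matrix.mulVec_mulVec, Matrix.mul_nonsing_inv A hA, Matrix.one_mulVec]
    rw [← h1, ← ha, h0, Matrix.mulVec_zero]
  have hαp : 0 < α := by
    obtain ⟨i, hi⟩ := Function.ne_iff.1 hane
    exact Finset.sum_pos' (fun j _ => sq_nonneg _) ⟨i, Finset.mem_univ i, by
      have : a i ≠ 0 := hi
      positivity⟩
  set κ := √(α / 2) with hκ
  have hκp : 0 < κ := sqrt_pos.2 (by positivity)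
  have hκ2 : κ ^ 2 = α / 2 := sq_sqrt (by positivity)
  have hsum : ∀ t x : ℝ, ∑ i, (A⁻¹.mulVec (μ + t • b - μ - x • β) i) ^ 2 =
      t ^ 2 * α - 2 * t * x * δ + x ^ 2 * γ := by
    intro t x
    rw [hα, hδ, hγ, Finset.mul_sum, Finset.mul_sum, Finset.mul_sum, ← Finset.sum_sub_distrib,
      ← Finset.sum_add_distrib]
    refine Finset.sum_congr rfl fun i _ => ?_
    have : A⁻¹.mulVec (μ + t • b - μ - x • β) = t • a - x • c := by
      rw [add_sub_cancel_left, Matrix.mulVec_sub, Matrix.mulVec_smul, Matrix.mulVec_smul]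
    rw [this]
    simp only [Pi.sub_apply, Pi.smul_apply, smul_eq_mul]
    ring
  set h : ℝ → ℝ := fun x => x ^ (-((p:ℝ) - 1)/2) * g x * exp (-(γ / 2 * x)) with hh
  have hfun : ∀ t : ℝ, ∀ x ∈ Ioi (0:ℝ), (2 * π * x) ^ (-(p:ℝ)/2) *
        Real.exp (-(∑ i, (A⁻¹.mulVec (μ + t • b - μ - x • β) i) ^ 2) / (2 * x)) * g x =
      ((2 * π) ^ (-(p:ℝ)/2) * exp (δ * t)) *
        ((√x)⁻¹ * exp (-((κ * t) ^ 2 / x)) * h x) := by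
    intro t x hx
    have hx : 0 < x := hx
    rw [hsum, mul_rpow (by positivity) hx.le]
    have e1 : x ^ (-(p:ℝ)/2) = x ^ (-((p:ℝ) - 1)/2) * (√x)⁻¹ := by
      rw [sqrt_eq_rpow, ← rpow_neg hx.le, ← rpow_add hx]
      congr 1; ring
    have e2 : exp (-(t ^ 2 * α - 2 * t * x * δ + x ^ 2 * γ) / (2 * x)) =
        exp (δ * t) * exp (-((κ * t) ^ 2 / x)) * exp (-(γ / 2 * x)) := by
      rw [← exp_add, ← exp_add]
      congr 1
      rw [mul_pow, hκ2]
      field_simp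
      ring
    rw [e1, e2]
    simp only [hh]
    ring
  set H : ℝ → ℝ := fun t => ∫ x in Ioi (0:ℝ), (√x)⁻¹ * exp (-(t ^ 2 / x)) * h x with hH
  have hP : (0:ℝ) < (2 * π) ^ (-(p:ℝ)/2) := by positivity
  have hpos : ∀ x ∈ Ioi (0:ℝ), 0 < h x := fun x hx => mul_pos (hg_pos' x hx) (exp_pos _)
  have hlc : ∀ x₁ ∈ Ioi (0:ℝ), ∀ x₂ ∈ Ioi (0:ℝ), ∀ θ ∈ Ioo (0:ℝ) 1,
      h (θ * x₁ + (1 - θ) * x₂) ≤ h x₁ ^ θ * h x₂ ^ (1 - θ) := by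
    intro x hx y hy θ hθ
    simp only [hh]
    have e : exp (-(γ / 2 * (θ * x + (1 - θ) * y))) =
        exp (-(γ / 2 * x)) ^ θ * exp (-(γ / 2 * y)) ^ (1 - θ) := by
      rw [← exp_mul, ← exp_mul, ← exp_add]; congr 1; ring
    rw [mul_rpow (hg_pos' x hx).le (exp_pos _).le, mul_rpow (hg_pos' y hy).le (exp_pos _).le, e]
    have h1 := mul_le_mul_of_nonneg_right (hg_lcx x hx y hy θ hθ)
      (by positivity : 0 ≤ exp (-(γ / 2 * x)) ^ θ * exp (-(γ / 2 * y)) ^ (1 - θ))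
    linear_combination h1
  have hint : ∀ t, 0 < t →
      IntegrableOn (fun x => (√x)⁻¹ * exp (-(t ^ 2 / x)) * h x) (Ioi 0) := by
    intro t ht
    have h1 := IntegrableOn.congr_fun (hf_int (μ + (t / κ) • b)) (hfun (t / κ)) hmeas
    have h2 : (2 * π) ^ (-(p:ℝ)/2) * exp (δ * (t / κ)) ≠ 0 := by positivity
    have h3 := h1.const_mul ((2 * π) ^ (-(p:ℝ)/2) * exp (δ * (t / κ)))⁻¹
    refine IntegrableOn.congr_fun h3 (fun x hx => ?_) hmeas
    rw [inv_mul_cancel_left₀ h2, mul_div_cancel₀ t hκp.ne']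
  obtain ⟨Hpos, Hlc⟩ := aux_core' h hpos hlc H (fun t => rfl) hint
  set K := |A.det|⁻¹ * (2 * π) ^ (-(p:ℝ)/2) with hK
  have hKp : 0 < K := mul_pos (inv_pos.2 (abs_pos.2 hA.ne_zero)) hP
  have hfH : ∀ t : ℝ, f (μ + t • b) = K * exp (δ * t) * H (κ * t) := by
    intro t
    rw [hf, setIntegral_congr_fun hmeas (hfun t), integral_const_mul]
    simp only [hK, hH]
    ring
  refine ⟨fun t ht => ?_, fun t1 ht1 t2 ht2 θ hθ => ?_⟩
  · rw [hfH]
    have := Hpos (κ * t) (mul_pos hκp ht)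
    positivity
  · have p1 := Hpos (κ * t1) (mul_pos hκp ht1)
    have p2 := Hpos (κ * t2) (mul_pos hκp ht2)
    have h1 := Hlc (κ * t1) (κ * t2) θ (mul_pos hκp ht1) (mul_pos hκp ht2) hθ
    have e0 : θ * (κ * t1) + (1 - θ) * (κ * t2) = κ * (θ * t1 + (1 - θ) * t2) := by ring
    rw [e0] at h1
    rw [hfH, hfH, hfH, mul_rpow (by positivity) p1.le, mul_rpow (by positivity) p2.le]
    have e : K * exp (δ * (θ * t1 + (1 - θ) * t2)) =
        (K * exp (δ * t1)) ^ θ * (K * exp (δ * t2)) ^ (1 - θ) := by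
      have e (q : ℝ) : K * exp q = exp (log K + q) := by rw [exp_add, exp_log hKp]
      rw [e, e, e, ← exp_mul, ← exp_mul, ← exp_add]
      congr 1
      ring
    rw [e]
    have h2 := mul_le_mul_of_nonneg_left h1
      (by positivity : 0 ≤ (K * exp (δ * t1)) ^ θ * (K * exp (δ * t2)) ^ (1 - θ))
    linear_combination h2
end

section
/- Let p ≥ 1, let μ, β be vectors in ℝ^p, let A be an invertible p×p real matrix, and let λ, χ, ψ ∈ ℝ satisfy: (χ ≥ 0 and ψ > 0) if λ > 0; (χ > 0 and ψ > 0) if λ = 0; (χ > 0 and ψ ≥ 0) if λ < 0; assume also ψ + βᵀ(AAᵀ)⁻¹β > 0 or λ < p/2, so that the integral converges for y off the line. Define f : ℝ^p → [0,∞] by f(y) = |det A|^{-1} ∫₀^∞ (2πx)^{-p/2} · exp(−‖A⁻¹(y − μ − xβ)‖²/(2x)) · x^{λ−1} exp(−(χ/x + ψx)/2) dx. Then for every c ∈ ℝ the superlevel set {y ∈ ℝ^p : f(y) ≥ c} is convex. -/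
open MeasureTheory Set Real ENNReal

lemma barrier_le {y y' : ℝ → ℝ} {s0 : ℝ} (hy : ∀ s, s0 ≤ s → HasDerivAt y (y' s) s)
    {c : ℝ} (h0 : y s0 ≤ c) (hb : ∀ s, s0 ≤ s → y s = c → y' s < 0) :
    ∀ s, s0 ≤ s → y s ≤ c := by
  intro s hs
  refine image_le_of_deriv_right_lt_deriv_boundary' (f := y) (f' := y') (B := fun _ => c)
    (B' := fun _ => 0) (a := s0) (b := s) ?_ ?_ h0 continuousOn_const ?_ ?_ (right_mem_Icc.2 hs)
  · intro x hx; exact (hy x hx.1).continuousAt.continuousWithinAt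
  · intro x hx; exact (hy x hx.1).hasDerivWithinAt
  · intro x hx; exact hasDerivWithinAt_const _ _ _
  · intro x hx h; exact hb x hx.1 h

lemma anti_of_deriv {y y' : ℝ → ℝ} {s0 : ℝ} (hy : ∀ s, s0 ≤ s → HasDerivAt y (y' s) s)
    (hb : ∀ s, s0 ≤ s → y' s ≤ 0) : ∀ s t, s0 ≤ s → s ≤ t → y t ≤ y s := by
  have : AntitoneOn y (Ici s0) := by
    refine antitoneOn_of_hasDerivWithinAt_nonpos (f' := y') (convex_Ici s0) ?_ ?_ ?_
    · intro x hx; exact (hy x hx).continuousAt.continuousWithinAt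
    · intro x hx; exact (hy x (interior_subset hx)).hasDerivWithinAt
    · intro x hx; exact hb x (interior_subset hx)
  intro s t hs hst
  exact this hs (le_trans hs hst) hst

section ode
variable {m : ℝ → ℝ} {κ a : ℝ}

lemma ode_no (hm : ∀ s, 0 < s → 0 < m s)
    (hd : ∀ s, 0 < s → HasDerivAt m ((s * m s ^ 2 - κ * m s - a) / (2 * s)) s)
    {s1 ε : ℝ} (hs1 : 0 < s1) (hε : 0 < ε)
    (hB : ∀ s, s1 ≤ s → s * m s ^ 2 + (1 - κ) * m s - a ≤ -ε) : False := by
  have h1 : ∀ s, s1 ≤ s → HasDerivAt (fun s => √s * (m s + ε))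
      ((s * m s ^ 2 + (1 - κ) * m s - a + ε) / (2 * √s)) s := by
    intro s hs
    have hs0 : 0 < s := by linarith
    have := (Real.hasDerivAt_sqrt hs0.ne').mul ((hd s hs0).add_const ε)
    refine this.congr_deriv ?_
    have h2 : 0 < √s := Real.sqrt_pos.2 hs0
    have h3 : s = √s ^ 2 := (Real.sq_sqrt hs0.le).symm
    generalize m s = M at *
    generalize √s = r at *
    subst h3
    field_simp
    ring
  have h2 := anti_of_deriv h1 (by
    intro s hs
    apply div_nonpos_of_nonpos_of_nonneg
    · linarith [hB s hs]
    · positivity)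
  set C := √s1 * (m s1 + ε) with hC
  have hC0 : 0 ≤ C := by
    have := hm s1 hs1
    positivity
  set t := s1 + ((C + 1) / ε) ^ 2 with ht
  have h3 := h2 s1 t le_rfl (by rw [ht]; nlinarith [sq_nonneg ((C+1)/ε)])
  have h4 : (C + 1) / ε ≤ √t := Real.le_sqrt_of_sq_le (by rw [ht]; linarith)
  have h5 : 0 < m t := hm t (by rw [ht]; positivity)
  have h6 : C + 1 ≤ √t * ε := by rwa [div_le_iff₀ hε] at h4
  have h7 : 0 ≤ √t * m t := by positivity
  nlinarith

lemma ode_P (hd : ∀ s, 0 < s → HasDerivAt m ((s * m s ^ 2 - κ * m s - a) / (2 * s)) s)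
    {s : ℝ} (hs : 0 < s) : HasDerivAt (fun s => s * m s ^ 2)
      (m s * (s * m s ^ 2 + (1 - κ) * m s - a)) s := by
  refine ((hasDerivAt_id s).mul ((hd s hs).pow 2)).congr_deriv ?_
  simp
  field_simp
  ring

lemma ode_B (hm : ∀ s, 0 < s → 0 < m s)
    (hd : ∀ s, 0 < s → HasDerivAt m ((s * m s ^ 2 - κ * m s - a) / (2 * s)) s)
    (hκ : κ ≤ 1) {s : ℝ} (hs : 0 < s) : 0 ≤ s * m s ^ 2 + (1 - κ) * m s - a := by
  by_contra! hneg
  have h := barrier_le (y := fun s => s * m s ^ 2 + (1 - κ) * m s - a) (s0 := s)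
    (c := s * m s ^ 2 + (1 - κ) * m s - a)
    (fun x hx => ((ode_P hd (hs.trans_le hx)).add ((hd x (hs.trans_le hx)).const_mul (1-κ))).sub_const a)
    le_rfl (by
      intro x hx he
      have hx0 := hs.trans_le hx
      have hmx := hm x hx0
      have hB : x * m x ^ 2 + (1 - κ) * m x - a < 0 := by rw [he]; exact hneg
      have h1 : m x * (x * m x ^ 2 + (1 - κ) * m x - a) < 0 := mul_neg_of_pos_of_neg hmx hB
      have h2 : (x * m x ^ 2 - κ * m x - a) / (2 * x) ≤ 0 := by
        apply div_nonpos_of_nonpos_of_nonneg <;> linarith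
      have h3 : (1 - κ) * ((x * m x ^ 2 - κ * m x - a) / (2 * x)) ≤ 0 :=
        mul_nonpos_of_nonneg_of_nonpos (by linarith) h2
      linarith)
  exact ode_no hm hd hs (ε := -(s * m s ^ 2 + (1 - κ) * m s - a)) (by linarith)
    (fun x hx => by have := h x hx; linarith)

lemma ode_A (hm : ∀ s, 0 < s → 0 < m s)
    (hd : ∀ s, 0 < s → HasDerivAt m ((s * m s ^ 2 - κ * m s - a) / (2 * s)) s)
    (hκ : 1 < κ) {s : ℝ} (hs : 0 < s) : a < s * m s ^ 2 := by
  by_contra! hneg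
  have hder : ∀ x, s ≤ x → HasDerivAt (fun s => s * m s ^ 2)
      (m x * (x * m x ^ 2 + (1 - κ) * m x - a)) x := fun x hx => ode_P hd (hs.trans_le hx)
  have hn : ∀ x, s ≤ x → x * m x ^ 2 ≤ a → m x * (x * m x ^ 2 + (1 - κ) * m x - a) < 0 := by
    intro x hx he
    have hmx := hm x (hs.trans_le hx)
    apply mul_neg_of_pos_of_neg hmx
    nlinarith
  have h := barrier_le hder hneg (fun x hx he => hn x hx he.le)
  have hanti := anti_of_deriv hder (fun x hx => (hn x hx (h x hx)).le)
  have hst : StrictAntiOn (fun s => s * m s ^ 2) (Ici s) := by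
    refine strictAntiOn_of_hasDerivWithinAt_neg (convex_Ici s) (fun x hx => (hder x hx).continuousAt.continuousWithinAt)
      (fun x hx => (hder x (interior_subset hx)).hasDerivWithinAt)
      (fun x hx => hn x (interior_subset hx) (h x (interior_subset hx)))
  have h1 := hst (mem_Ici.2 le_rfl) (mem_Ici.2 (by linarith : s ≤ s + 1)) (by linarith)
  simp only at h1
  refine ode_no hm hd (s1 := s + 1) (ε := a - (s+1) * m (s+1) ^ 2) (by linarith) (by linarith) ?_
  intro x hx
  have h2 := hanti (s+1) x (by linarith) hx
  have hmx := hm x (by linarith)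
  nlinarith

lemma ode_J (ha : 0 < a) (hm : ∀ s, 0 < s → 0 < m s)
    (hd : ∀ s, 0 < s → HasDerivAt m ((s * m s ^ 2 - κ * m s - a) / (2 * s)) s)
    (hκ : 1 < κ) {s : ℝ} (hs : 0 < s) : 0 < s * m s ^ 3 + a * (s * m s ^ 2 - κ * m s - a) := by
  by_contra! hneg
  have hJd : ∀ x, s ≤ x → HasDerivAt (fun s => (s * m s ^ 2 - a) * (m s + a) - a * (κ - 1) * m s)
      (m x * (x * m x ^ 2 + (1 - κ) * m x - a) * (m x + a) + (x * m x ^ 2 - a) *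
        ((x * m x ^ 2 - κ * m x - a) / (2 * x)) -
        a * (κ - 1) * ((x * m x ^ 2 - κ * m x - a) / (2 * x))) x := by
    intro x hx
    have hx0 := hs.trans_le hx
    exact (((ode_P hd hx0).sub_const a).mul ((hd x hx0).add_const a)).sub
      ((hd x hx0).const_mul _)
  have h := barrier_le hJd (c := 0) (by linarith) (by
    intro x hx he
    have hx0 := hs.trans_le hx
    have hmx := hm x hx0
    have hA := ode_A hm hd hκ hx0
    generalize m x = M at *
    have e1 : x * M ^ 2 - κ * M - a = - (x * M ^ 3 / a) := by
      field_simp; linarith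
    have e2 : (x * M ^ 2 - κ * M - a) / (2 * x) = - (M ^ 3 / (2 * a)) := by
      rw [e1]; field_simp
    have e3 : x * M ^ 2 + (1 - κ) * M - a = - ((x * M ^ 2 - a) * M / a) := by
      field_simp; linarith
    have e4 : a * (κ - 1) = (x * M ^ 2 - a) * (M + a) / M := by
      field_simp; linarith
    rw [e2, e3, e4]
    have : M * -((x * M ^ 2 - a) * M / a) * (M + a) + (x * M ^ 2 - a) * -(M ^ 3 / (2 * a)) -
      (x * M ^ 2 - a) * (M + a) / M * -(M ^ 3 / (2 * a)) = - ((x * M ^ 2 - a) * (M^2 * (M / a + 1/2))) := by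
      field_simp; ring
    rw [this]
    have : 0 < x * M ^ 2 - a := by linarith
    have : 0 < (x * M ^ 2 - a) * (M^2 * (M / a + 1/2)) := by positivity
    linarith)
  have hDd : ∀ x, s ≤ x → HasDerivAt (fun s => s - a / m s ^ 2)
      (1 + a * (x * m x ^ 2 - κ * m x - a) / (x * m x ^ 3)) x := by
    intro x hx
    have hx0 := hs.trans_le hx
    have hmx := hm x hx0
    refine ((hasDerivAt_id x).sub ((hasDerivAt_const x a).div ((hd x hx0).pow 2) (pow_pos hmx 2).ne')).congr_deriv ?_
    simp
    field_simp
    ring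
  have hD := anti_of_deriv hDd (by
    intro x hx
    have hx0 := hs.trans_le hx
    have hmx := hm x hx0
    have h1 := h x hx
    have : 1 + a * (x * m x ^ 2 - κ * m x - a) / (x * m x ^ 3) =
      (x * m x ^ 3 + a * (x * m x ^ 2 - κ * m x - a)) / (x * m x ^ 3) := by field_simp
    rw [this]
    apply div_nonpos_of_nonpos_of_nonneg
    · linarith
    · positivity)
  set C := s - a / m s ^ 2 with hC
  have hC0 : 0 < C := by
    have h1 := ode_A hm hd hκ hs
    have := hm s hs
    rw [hC, sub_pos, div_lt_iff₀ (by positivity)]; exact h1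
  have hAle : ∀ x, s ≤ x → x * m x ^ 2 - a ≤ C * m x ^ 2 := by
    intro x hx
    have hmx := hm x (hs.trans_le hx)
    have h1 := hD s x le_rfl hx
    simp only [← hC] at h1
    have : x * m x ^ 2 - a = (x - a / m x ^ 2) * m x ^ 2 := by field_simp
    rw [this]
    exact mul_le_mul_of_nonneg_right h1 (by positivity)
  set δ := κ - 1 with hδ
  have hδ0 : 0 < δ := by linarith
  set s2 := s + C + 4 * a * C ^ 2 / δ ^ 2 with hs2
  have hs2s : s ≤ s2 := by
    have : 0 ≤ 4 * a * C ^ 2 / δ ^ 2 := by positivity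
    linarith
  have hsm : ∀ x, s2 ≤ x → C * m x ≤ δ / 2 := by
    intro x hx
    have hmx := hm x (by linarith)
    have h1 := hAle x (hs2s.trans hx)
    have h2 : (x - C) * m x ^ 2 ≤ a := by linarith
    have h3 : 4 * a * C ^ 2 / δ ^ 2 * m x ^ 2 ≤ a := by
      refine le_trans (mul_le_mul_of_nonneg_right ?_ (by positivity)) h2
      linarith
    have h4 : 4 * C ^ 2 * m x ^ 2 ≤ δ ^ 2 := by
      have : 4 * a * C ^ 2 / δ ^ 2 * m x ^ 2 = a * (4 * C ^ 2 * m x ^ 2) / δ ^ 2 := by field_simp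
      rw [this, div_le_iff₀ (by positivity)] at h3
      exact le_of_mul_le_mul_left h3 ha
    have : 2 * C * m x ≤ δ := abs_le_of_sq_le_sq' (by linarith) hδ0.le |>.2
    linarith
  have hQd : ∀ x, s2 ≤ x → HasDerivAt (fun s => s * m s ^ 2 + δ * a / 2 * Real.log s)
      (m x * (x * m x ^ 2 + (1 - κ) * m x - a) + δ * a / 2 * x⁻¹) x := by
    intro x hx
    have hx0 : 0 < x := by linarith
    exact (ode_P hd hx0).add ((Real.hasDerivAt_log hx0.ne').const_mul _)
  have hQ := anti_of_deriv hQd (by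
    intro x hx
    have hx0 : 0 < x := by linarith
    have hmx := hm x hx0
    have h1 := hAle x (hs2s.trans hx)
    have h2 := hsm x hx
    have hA := ode_A hm hd hκ hx0
    have h3 : x * m x ^ 2 + (1 - κ) * m x - a ≤ - (δ / 2) * m x := by
      have : C * m x ^ 2 ≤ δ / 2 * m x := by nlinarith
      have : (1 - κ) * m x = - δ * m x := by rw [hδ]; ring
      linarith
    have h4 : m x * (x * m x ^ 2 + (1 - κ) * m x - a) ≤ m x * (- (δ / 2) * m x) :=
      mul_le_mul_of_nonneg_left h3 hmx.le
    have h5 : a * x⁻¹ ≤ m x ^ 2 := by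
      rw [← div_eq_mul_inv, div_le_iff₀ hx0]; linarith
    have h6 := mul_le_mul_of_nonneg_left h5 (by linarith : 0 ≤ δ / 2)
    linarith)
  set Q := s2 * m s2 ^ 2 + δ * a / 2 * Real.log s2 with hQdef
  obtain ⟨t, ht1, ht2⟩ := ((Real.tendsto_log_atTop.eventually_ge_atTop (Q / (δ * a / 2))).and
    (Filter.eventually_ge_atTop s2)).exists
  have h1 := hQ s2 t le_rfl ht2
  have hA := ode_A hm hd hκ (show 0 < t by linarith)
  rw [div_le_iff₀ (by positivity)] at ht1
  simp only [← hQdef] at h1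
  linarith
end ode

noncomputable def gigG (ν a s u : ℝ) : ℝ := Real.exp (ν * u - (s * Real.exp (-u) + a * Real.exp u) / 2)
noncomputable def gigH (ν a s : ℝ) : ℝ := ∫ u, gigG ν a s u

lemma gigG_pos (ν a s u : ℝ) : 0 < gigG ν a s u := Real.exp_pos _

lemma gigG_cont (ν a s : ℝ) : Continuous (gigG ν a s) := by
  unfold gigG; fun_prop

lemma exp_add_exp_neg_ge (u : ℝ) : u ^ 2 / 2 ≤ Real.exp (-u) + Real.exp u := by
  rcases le_total 0 u with h | h
  · have := Real.quadratic_le_exp_of_nonneg h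
    have := Real.exp_pos (-u)
    linarith
  · have := Real.quadratic_le_exp_of_nonneg (neg_nonneg.2 h)
    have := Real.exp_pos u
    nlinarith

lemma gigG_integrable (ν : ℝ) {a s : ℝ} (ha : 0 < a) (hs : 0 < s) : Integrable (gigG ν a s) := by
  set e := min a s with he
  have he0 : 0 < e := lt_min ha hs
  have h1 : Integrable (fun u : ℝ => Real.exp (2 * ν ^ 2 / e) * Real.exp (-(e / 8) * u ^ 2)) :=
    (integrable_exp_neg_mul_sq (by positivity)).const_mul _
  refine h1.mono' (gigG_cont ν a s).aestronglyMeasurable (Filter.Eventually.of_forall fun u => ?_)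
  rw [Real.norm_of_nonneg (gigG_pos _ _ _ _).le, ← Real.exp_add, gigG, Real.exp_le_exp]
  have h2 := exp_add_exp_neg_ge u
  have h3 : e * Real.exp (-u) ≤ s * Real.exp (-u) :=
    mul_le_mul_of_nonneg_right (min_le_right _ _) (Real.exp_pos _).le
  have h4 : e * Real.exp u ≤ a * Real.exp u :=
    mul_le_mul_of_nonneg_right (min_le_left _ _) (Real.exp_pos _).le
  have h5 := mul_le_mul_of_nonneg_left h2 he0.le
  have h6 : ν * u ≤ 2 * ν ^ 2 / e + (e / 8) * u ^ 2 := by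
    have : 0 ≤ (4 * ν - e * u) ^ 2 / (8 * e) := by positivity
    have e1 : (4 * ν - e * u) ^ 2 / (8 * e) = 2 * ν ^ 2 / e + (e / 8) * u ^ 2 - ν * u := by
      field_simp; ring
    linarith
  linarith

lemma gigH_pos (ν : ℝ) {a s : ℝ} (ha : 0 < a) (hs : 0 < s) : 0 < gigH ν a s := by
  unfold gigH
  rw [integral_pos_iff_support_of_nonneg (fun u => (gigG_pos _ _ _ _).le) (gigG_integrable ν ha hs)]
  have : Function.support (gigG ν a s) = univ := by
    ext u; simp [(gigG_pos ν a s u).ne']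
  rw [this]; simp

lemma gigG_mul_exp (ν a s u c : ℝ) : Real.exp (c * u) * gigG ν a s u = gigG (ν + c) a s u := by
  unfold gigG; rw [← Real.exp_add]; congr 1; ring

lemma gigH_deriv (ν : ℝ) {a s : ℝ} (ha : 0 < a) (hs : 0 < s) :
    HasDerivAt (gigH ν a) (-(1/2) * gigH (ν - 1) a s) s := by
  have key := hasDerivAt_integral_of_dominated_loc_of_deriv_le (μ := volume) (x₀ := s)
    (F := fun s u => gigG ν a s u) (F' := fun s u => -(1/2) * gigG (ν - 1) a s u)
    (bound := fun u => (1/2) * gigG (ν - 1) a (s/2) u) (s := Ioi (s/2))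
    (Ioi_mem_nhds (by linarith))
    (Filter.Eventually.of_forall fun x => (gigG_cont ν a x).aestronglyMeasurable)
    (gigG_integrable ν ha hs)
    ((gigG_cont (ν-1) a s).const_mul _).aestronglyMeasurable
    (Filter.Eventually.of_forall fun u x hx => by
      rw [norm_mul, Real.norm_of_nonneg (gigG_pos _ _ _ _).le]
      have : gigG (ν - 1) a x u ≤ gigG (ν - 1) a (s/2) u := by
        unfold gigG
        rw [Real.exp_le_exp]
        have : s / 2 * Real.exp (-u) ≤ x * Real.exp (-u) :=
          mul_le_mul_of_nonneg_right (mem_Ioi.1 hx).le (Real.exp_pos _).le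
        linarith
      norm_num
      linarith)
    ((gigG_integrable (ν-1) ha (by linarith)).const_mul _)
    (Filter.Eventually.of_forall fun u x hx => by
      have h1 : HasDerivAt (fun s => ν * u - (s * Real.exp (-u) + a * Real.exp u) / 2)
          (-(1/2) * Real.exp (-u)) x := by
        refine (((((hasDerivAt_id x).mul_const (Real.exp (-u))).add_const (a * Real.exp u)).div_const 2).const_sub (ν * u)).congr_deriv ?_
        ring
      refine h1.exp.congr_deriv ?_
      have := gigG_mul_exp ν a x u (-1)
      rw [show ν - 1 = ν + -1 by ring, ← this]
      unfold gigG
      rw [show -1 * u = -u by ring]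
      ring)
  have h2 := key.2
  rw [integral_const_mul] at h2
  exact h2

lemma gigH_rec (ν : ℝ) {a s : ℝ} (ha : 0 < a) (hs : 0 < s) :
    ν * gigH ν a s + s / 2 * gigH (ν - 1) a s - a / 2 * gigH (ν + 1) a s = 0 := by
  have i0 := (gigG_integrable ν ha hs).const_mul ν
  have i1 := (gigG_integrable (ν - 1) ha hs).const_mul (s / 2)
  have i2 := (gigG_integrable (ν + 1) ha hs).const_mul (a / 2)
  have := integral_eq_zero_of_hasDerivAt_of_integrable (f := gigG ν a s)
    (f' := fun u => ν * gigG ν a s u + s / 2 * gigG (ν - 1) a s u - a / 2 * gigG (ν + 1) a s u)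
    (fun u => by
      have h1 : HasDerivAt (fun u => ν * u - (s * Real.exp (-u) + a * Real.exp u) / 2)
          (ν - (s * (Real.exp (-u) * (-1)) + a * Real.exp u) / 2) u := by
        refine (((hasDerivAt_id u).const_mul ν).sub (((((hasDerivAt_id u).neg.exp).const_mul s).add
          ((Real.hasDerivAt_exp u).const_mul a)).div_const 2)).congr_deriv ?_
        simp
      refine h1.exp.congr_deriv ?_
      have e1 := gigG_mul_exp ν a s u (-1)
      have e2 := gigG_mul_exp ν a s u 1
      rw [show ν - 1 = ν + -1 by ring, ← e1, ← e2]
      unfold gigG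
      rw [show -1 * u = -u by ring, one_mul]
      ring) ((i0.add i1).sub i2) (gigG_integrable ν ha hs)
  have e := integral_sub (i0.add i1) i2
  simp only [Pi.add_apply] at e
  rw [e, integral_add i0 i1, integral_const_mul, integral_const_mul,
    integral_const_mul] at this
  exact this

lemma gigH_log_deriv (ν : ℝ) {a s : ℝ} (ha : 0 < a) (hs : 0 < s) :
    HasDerivAt (fun s => Real.log (gigH ν a s)) (-(gigH (ν - 1) a s / gigH ν a s / 2)) s := by
  have h := gigH_pos ν ha hs
  refine ((gigH_deriv ν ha hs).log h.ne').congr_deriv ?_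
  field_simp

lemma gigm_deriv (ν : ℝ) {a s : ℝ} (ha : 0 < a) (hs : 0 < s) :
    HasDerivAt (fun s => gigH (ν - 1) a s / gigH ν a s)
      ((s * (gigH (ν - 1) a s / gigH ν a s) ^ 2 - (2 * (1 - ν)) * (gigH (ν - 1) a s / gigH ν a s) - a)
        / (2 * s)) s := by
  have h := gigH_pos ν ha hs
  refine ((gigH_deriv (ν-1) ha hs).div (gigH_deriv ν ha hs) h.ne').congr_deriv ?_
  have hr := gigH_rec (ν - 1) ha hs
  rw [show ν - 1 + 1 = ν by ring] at hr
  generalize gigH (ν - 1 - 1) a s = X at *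
  generalize gigH (ν - 1) a s = Y at *
  generalize gigH ν a s = Z at *
  have hX : X = (a / 2 * Z - (ν - 1) * Y) * 2 / s := by field_simp; linarith
  rw [hX]
  field_simp
  ring

/-- first criterion -/
lemma core_one {ℓ m : ℝ → ℝ} {κ a : ℝ} (ha : 0 < a) (hm : ∀ s, 0 < s → 0 < m s)
    (hl : ∀ s, 0 < s → HasDerivAt ℓ (-(m s / 2)) s)
    (hd : ∀ s, 0 < s → HasDerivAt m ((s * m s ^ 2 - κ * m s - a) / (2 * s)) s)
    (hJ : ∀ s, 0 < s → 0 < s * m s ^ 3 + a * (s * m s ^ 2 - κ * m s - a))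
    (s0 s1 t0 τ : ℝ) (hτ : τ ≠ 0)
    (hσ : ∀ θ ∈ Icc (0:ℝ) 1, 0 < s0 + θ * (s1 - s0) - θ * (1 - θ) * (τ ^ 2 / a))
    (θ : ℝ) (hθ : θ ∈ Icc (0:ℝ) 1) :
    min (t0 + ℓ s0) (t0 + τ + ℓ s1) ≤
      t0 + θ * τ + ℓ (s0 + θ * (s1 - s0) - θ * (1 - θ) * (τ ^ 2 / a)) := by
  set σ : ℝ → ℝ := fun θ => s0 + θ * (s1 - s0) - θ * (1 - θ) * (τ ^ 2 / a) with hσdef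
  set σ' : ℝ → ℝ := fun θ => (s1 - s0) - (1 - 2 * θ) * (τ ^ 2 / a) with hσ'def
  have dσ : ∀ x, HasDerivAt σ (σ' x) x := by
    intro x
    have := (((hasDerivAt_id x).mul_const (s1 - s0)).const_add s0).sub
      (((hasDerivAt_id x).mul ((hasDerivAt_id x).const_sub 1)).mul_const (τ ^ 2 / a))
    refine this.congr_deriv ?_
    simp only [hσ'def, id]; ring
  have dσ' : ∀ x, HasDerivAt σ' (2 * (τ ^ 2 / a)) x := by
    intro x
    have := ((((hasDerivAt_id x).const_mul 2).const_sub 1).mul_const (τ ^ 2 / a)).const_sub (s1 - s0)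
    refine this.congr_deriv ?_
    simp
  set g : ℝ → ℝ := fun θ => t0 + θ * τ + ℓ (σ θ) with hg
  set g' : ℝ → ℝ := fun θ => τ - m (σ θ) / 2 * σ' θ with hg'
  have dg : ∀ x ∈ Icc (0:ℝ) 1, HasDerivAt g (g' x) x := by
    intro x hx
    have := (((hasDerivAt_id x).mul_const τ).const_add t0).add ((hl _ (hσ x hx)).comp x (dσ x))
    refine this.congr_deriv ?_
    simp [hg']; ring
  set g'' : ℝ → ℝ := fun x => -(((σ x * m (σ x) ^ 2 - κ * m (σ x) - a) / (2 * σ x)) * σ' x / 2 * σ' x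
    + m (σ x) / 2 * (2 * (τ ^ 2 / a))) with hg''
  have dg' : ∀ x ∈ Icc (0:ℝ) 1, HasDerivAt g' (g'' x) x := by
    intro x hx
    have := ((((hd _ (hσ x hx)).comp x (dσ x)).div_const 2).mul (dσ' x)).const_sub τ
    exact this
  have hneg : ∀ x ∈ Icc (0:ℝ) 1, g' x = 0 → g'' x < 0 := by
    intro x hx h0
    have hs := hσ x hx
    have hmx := hm _ hs
    have hJx := hJ _ hs
    simp only [hg'] at h0
    simp only [hg'']
    change 0 < σ x at hs
    change 0 < m (σ x) at hmx
    change 0 < σ x * m (σ x) ^ 3 + a * (σ x * m (σ x) ^ 2 - κ * m (σ x) - a) at hJx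
    generalize σ x = S at *
    generalize m S = M at *
    have e : σ' x = 2 * τ / M := by field_simp; linarith
    rw [e]
    have : -((S * M ^ 2 - κ * M - a) / (2 * S) * (2 * τ / M) / 2 * (2 * τ / M) + M / 2 * (2 * (τ ^ 2 / a)))
      = - (τ ^ 2 * (S * M ^ 3 + a * (S * M ^ 2 - κ * M - a)) / (S * M ^ 2 * a)) := by
      field_simp; ring
    rw [this]
    have : 0 < τ ^ 2 := by positivity
    have : 0 < τ ^ 2 * (S * M ^ 3 + a * (S * M ^ 2 - κ * M - a)) / (S * M ^ 2 * a) := by positivity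
    linarith
  have hbar : ∀ x y, 0 ≤ x → x ≤ y → y ≤ 1 → g' x ≤ 0 → g' y ≤ 0 := by
    intro x y hx hxy hy h0
    refine image_le_of_deriv_right_lt_deriv_boundary' (f := g') (f' := g'') (B := fun _ => 0)
      (B' := fun _ => 0) (a := x) (b := y) ?_ ?_ h0 continuousOn_const ?_ ?_ (right_mem_Icc.2 hxy)
    · intro z hz; exact (dg' z ⟨hx.trans hz.1, hz.2.trans hy⟩).continuousAt.continuousWithinAt
    · intro z hz; exact (dg' z ⟨hx.trans hz.1, hz.2.le.trans hy⟩).hasDerivWithinAt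
    · intro z hz; exact hasDerivWithinAt_const _ _ _
    · intro z hz h; exact hneg z ⟨hx.trans hz.1, hz.2.le.trans hy⟩ h
  have g0 : g 0 = t0 + ℓ s0 := by simp [hg, hσdef]
  have g1 : g 1 = t0 + τ + ℓ s1 := by simp [hg, hσdef]
  rw [← g0, ← g1]
  change min (g 0) (g 1) ≤ g θ
  by_cases h : g' θ ≤ 0
  · refine (min_le_right _ _).trans ?_
    have : AntitoneOn g (Icc θ 1) := by
      refine antitoneOn_of_hasDerivWithinAt_nonpos (f' := g') (convex_Icc θ 1) ?_ ?_ ?_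
      · intro x hx; exact (dg x ⟨hθ.1.trans hx.1, hx.2⟩).continuousAt.continuousWithinAt
      · intro x hx
        have hx := interior_subset hx
        exact (dg x ⟨hθ.1.trans hx.1, hx.2⟩).hasDerivWithinAt
      · intro x hx
        have hx := interior_subset hx
        exact hbar θ x hθ.1 hx.1 hx.2 h
    exact this (left_mem_Icc.2 hθ.2) (right_mem_Icc.2 hθ.2) hθ.2
  · refine (min_le_left _ _).trans ?_
    have : MonotoneOn g (Icc 0 θ) := by
      refine monotoneOn_of_hasDerivWithinAt_nonneg (f' := g') (convex_Icc 0 θ) ?_ ?_ ?_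
      · intro x hx; exact (dg x ⟨hx.1, hx.2.trans hθ.2⟩).continuousAt.continuousWithinAt
      · intro x hx
        have hx := interior_subset hx
        exact (dg x ⟨hx.1, hx.2.trans hθ.2⟩).hasDerivWithinAt
      · intro x hx
        have hx := interior_subset hx
        by_contra! hc
        exact h (hbar x θ hx.1 hx.2 hθ.2 hc.le)
    exact this (left_mem_Icc.2 hθ.1) (right_mem_Icc.2 hθ.1) hθ.1

lemma core_two {ℓ m : ℝ → ℝ} {κ a : ℝ}
    (hl : ∀ s, 0 < s → HasDerivAt ℓ (-(m s / 2)) s)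
    (hd : ∀ s, 0 < s → HasDerivAt m ((s * m s ^ 2 - κ * m s - a) / (2 * s)) s)
    (hB : ∀ s, 0 < s → 0 ≤ s * m s ^ 2 + (1 - κ) * m s - a) :
    ConcaveOn ℝ (Ioi (0:ℝ)) (fun r => ℓ (r ^ 2)) := by
  have d1 : ∀ x, 0 < x → HasDerivAt (fun r => ℓ (r ^ 2)) (-(x * m (x ^ 2))) x := by
    intro x hx
    refine ((hl (x ^ 2) (by positivity)).comp x ((hasDerivAt_id x).pow 2)).congr_deriv ?_
    simp; ring
  have d2 : ∀ x, 0 < x → HasDerivAt (fun r => -(r * m (r ^ 2)))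
      (-(x ^ 2 * m (x^2) ^ 2 + (1 - κ) * m (x^2) - a)) x := by
    intro x hx
    refine ((hasDerivAt_id x).mul ((hd (x ^ 2) (by positivity)).comp x ((hasDerivAt_id x).pow 2))).neg.congr_deriv ?_
    simp; field_simp; ring
  refine concaveOn_of_hasDerivWithinAt2_nonpos (convex_Ioi 0)
    (f' := fun r => -(r * m (r ^ 2))) (f'' := fun x => (-(x ^ 2 * m (x^2) ^ 2 + (1 - κ) * m (x^2) - a))) ?_ ?_ ?_ ?_
  · intro x hx; exact (d1 x hx).continuousAt.continuousWithinAt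
  · intro x hx; exact (d1 x (interior_subset hx)).hasDerivWithinAt
  · intro x hx; exact (d2 x (interior_subset hx)).hasDerivWithinAt
  · intro x hx
    have := hB (x^2) (pow_pos (interior_subset hx) 2)
    linarith

lemma gigG_anti (ν a : ℝ) {s s' : ℝ} (h : s ≤ s') (u : ℝ) : gigG ν a s' u ≤ gigG ν a s u := by
  unfold gigG
  rw [Real.exp_le_exp]
  have : s * Real.exp (-u) ≤ s' * Real.exp (-u) := mul_le_mul_of_nonneg_right h (Real.exp_pos _).le
  linarith

lemma gig_log_anti (ν : ℝ) {a s s' : ℝ} (ha : 0 < a) (hs : 0 < s) (h : s ≤ s') :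
    Real.log (gigH ν a s') ≤ Real.log (gigH ν a s) := by
  apply Real.log_le_log (gigH_pos ν ha (hs.trans_le h))
  exact integral_mono (gigG_integrable ν ha (hs.trans_le h)) (gigG_integrable ν ha hs)
    (fun u => gigG_anti ν a h u)

lemma quasi_scalar (ν : ℝ) {a χ : ℝ} (ha : 0 < a) (hχ : 0 < χ) (t0 t1 n0 n1 c θ : ℝ)
    (hn0 : 0 ≤ n0) (hn1 : 0 ≤ n1) (hc : c ^ 2 ≤ n0 * n1)
    (ht : (t1 - t0) ^ 2 ≤ a * (n0 + n1 - 2 * c))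
    (hn : ∀ θ : ℝ, 0 ≤ (1 - θ) ^ 2 * n0 + 2 * θ * (1 - θ) * c + θ ^ 2 * n1)
    (hθ : θ ∈ Icc (0:ℝ) 1) :
    min (t0 + Real.log (gigH ν a (χ + n0))) (t1 + Real.log (gigH ν a (χ + n1))) ≤
      (1 - θ) * t0 + θ * t1 +
        Real.log (gigH ν a (χ + ((1 - θ) ^ 2 * n0 + 2 * θ * (1 - θ) * c + θ ^ 2 * n1))) := by
  set ℓ : ℝ → ℝ := fun s => Real.log (gigH ν a s) with hℓ
  set m : ℝ → ℝ := fun s => gigH (ν - 1) a s / gigH ν a s with hmdef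
  have hm : ∀ s, 0 < s → 0 < m s := fun s hs => div_pos (gigH_pos _ ha hs) (gigH_pos _ ha hs)
  have hl : ∀ s, 0 < s → HasDerivAt ℓ (-(m s / 2)) s := fun s hs => gigH_log_deriv ν ha hs
  have hd : ∀ s, 0 < s → HasDerivAt m ((s * m s ^ 2 - (2 * (1 - ν)) * m s - a) / (2 * s)) s :=
    fun s hs => gigm_deriv ν ha hs
  have hanti : ∀ s s', 0 < s → s ≤ s' → ℓ s' ≤ ℓ s := fun s s' hs h => gig_log_anti ν ha hs h
  change min (t0 + ℓ (χ + n0)) (t1 + ℓ (χ + n1)) ≤ (1 - θ) * t0 + θ * t1 + ℓ _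
  have hθ0 := hθ.1
  have hθ1 : 0 ≤ 1 - θ := sub_nonneg.2 hθ.2
  have hcomp : ∀ θ ∈ Icc (0:ℝ) 1, χ + ((1 - θ) ^ 2 * n0 + 2 * θ * (1 - θ) * c + θ ^ 2 * n1) ≤
      (χ + n0) + θ * ((χ + n1) - (χ + n0)) - θ * (1 - θ) * ((t1 - t0) ^ 2 / a) := by
    intro θ hθ
    have h1 : (t1 - t0) ^ 2 / a ≤ n0 + n1 - 2 * c := by
      rw [div_le_iff₀ ha]; linarith
    have h2 := mul_le_mul_of_nonneg_left h1 (mul_nonneg hθ.1 (sub_nonneg.2 hθ.2))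
    nlinarith
  rcases lt_or_ge 1 (2 * (1 - ν)) with hκ | hκ
  · by_cases hτ : t1 - t0 = 0
    · have e : t1 = t0 := by linarith
      subst e
      have h1 : (1 - θ) * t1 + θ * t1 = t1 := by ring
      rw [h1]
      have h2 := hcomp θ hθ
      simp only [sub_self, ne_eq, OfNat.ofNat_ne_zero, not_false_eq_true, zero_pow, zero_div,
        mul_zero, sub_zero] at h2
      have h3 : 0 < χ + ((1 - θ) ^ 2 * n0 + 2 * θ * (1 - θ) * c + θ ^ 2 * n1) := by
        linarith [hn θ]
      rcases le_total n0 n1 with h | h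
      · refine (min_le_right _ _).trans ?_
        have := hanti _ (χ + n1) h3 (by nlinarith)
        linarith
      · refine (min_le_left _ _).trans ?_
        have := hanti _ (χ + n0) h3 (by nlinarith)
        linarith
    · have := core_one ha hm hl hd (fun s hs => ode_J ha hm hd hκ hs) (χ + n0) (χ + n1) t0 (t1 - t0) hτ
        (fun θ hθ => lt_of_lt_of_le (by linarith [hn θ]) (hcomp θ hθ)) θ hθ
      rw [show t0 + (t1 - t0) = t1 by ring] at this
      refine this.trans ?_
      have h2 := hanti _ _ (by linarith [hn θ]) (hcomp θ hθ)
      have : t0 + θ * (t1 - t0) = (1 - θ) * t0 + θ * t1 := by ring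
      linarith
  · have hconc := core_two hl hd (fun s hs => ode_B hm hd hκ hs)
    have hs0 : 0 < χ + n0 := by linarith
    have hs1 : 0 < χ + n1 := by linarith
    have q0 := Real.sqrt_pos.2 hs0
    have q1 := Real.sqrt_pos.2 hs1
    have h1 := hconc.2 (mem_Ioi.2 q0) (mem_Ioi.2 q1) hθ1 hθ0 (by ring)
    simp only [smul_eq_mul, Real.sq_sqrt hs0.le, Real.sq_sqrt hs1.le] at h1
    have h2 : χ + c ≤ √(χ + n0) * √(χ + n1) := by
      rw [← Real.sqrt_mul hs0.le]
      apply Real.le_sqrt_of_sq_le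
      have : 2 * c ≤ n0 + n1 := by nlinarith [sq_nonneg (n0 - n1), sq_nonneg (n0 + n1 - 2 * c)]
      nlinarith
    have h3 : χ + ((1 - θ) ^ 2 * n0 + 2 * θ * (1 - θ) * c + θ ^ 2 * n1) ≤
        ((1 - θ) * √(χ + n0) + θ * √(χ + n1)) ^ 2 := by
      have e0 := Real.sq_sqrt hs0.le
      have e1 := Real.sq_sqrt hs1.le
      have h4 := mul_le_mul_of_nonneg_left h2 (mul_nonneg hθ0 hθ1)
      have : ((1 - θ) * √(χ + n0) + θ * √(χ + n1)) ^ 2 = (1 - θ) ^ 2 * (χ + n0) + θ ^ 2 * (χ + n1)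
        + 2 * (θ * (1 - θ) * (√(χ + n0) * √(χ + n1))) := by
        rw [← e0, ← e1]; simp only [Real.sqrt_sq q0.le, Real.sqrt_sq q1.le]; ring
      rw [this]; nlinarith
    have h5 := hanti _ _ (by linarith [hn θ]) h3
    have h6 : min (t0 + ℓ (χ + n0)) (t1 + ℓ (χ + n1)) ≤
        (1 - θ) * (t0 + ℓ (χ + n0)) + θ * (t1 + ℓ (χ + n1)) := by
      have a1 := mul_le_mul_of_nonneg_left (min_le_left (t0 + ℓ (χ + n0)) (t1 + ℓ (χ + n1))) hθ1
      have a2 := mul_le_mul_of_nonneg_left (min_le_right (t0 + ℓ (χ + n0)) (t1 + ℓ (χ + n1))) hθ0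
      linarith
    linarith

noncomputable def gigL (ν a s : ℝ) : ℝ≥0∞ := ∫⁻ u, ENNReal.ofReal (gigG ν a s u)

lemma gigL_eq (ν : ℝ) {a s : ℝ} (ha : 0 < a) (hs : 0 < s) (t : ℝ) :
    ENNReal.ofReal (Real.exp t) * gigL ν a s =
      ENNReal.ofReal (Real.exp (t + Real.log (gigH ν a s))) := by
  rw [Real.exp_add, Real.exp_log (gigH_pos ν ha hs), ENNReal.ofReal_mul (Real.exp_pos _).le, gigL, gigH,
    ofReal_integral_eq_lintegral_ofReal (gigG_integrable ν ha hs)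
      (Filter.Eventually.of_forall fun u => (gigG_pos _ _ _ _).le)]

lemma gigL_anti (ν a : ℝ) {s s' : ℝ} (h : s ≤ s') : gigL ν a s' ≤ gigL ν a s :=
  lintegral_mono fun u => ENNReal.ofReal_le_ofReal (gigG_anti ν a h u)

lemma gigL_tendsto (ν a s : ℝ) : Filter.Tendsto (fun n : ℕ => gigL ν a (s + 1 / ((n : ℝ) + 1)))
    Filter.atTop (nhds (gigL ν a s)) := by
  unfold gigL
  apply lintegral_tendsto_of_tendsto_of_monotone
  · intro n
    exact (gigG_cont _ _ _).measurable.ennreal_ofReal.aemeasurable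
  · refine Filter.Eventually.of_forall fun u n k hnk => ?_
    apply ENNReal.ofReal_le_ofReal
    apply gigG_anti
    have := Nat.one_div_le_one_div (α := ℝ) hnk
    linarith
  · refine Filter.Eventually.of_forall fun u => ?_
    apply ENNReal.tendsto_ofReal
    have h1 : Continuous (fun s => gigG ν a s u) := by unfold gigG; fun_prop
    have h2 : Filter.Tendsto (fun n : ℕ => s + 1 / ((n : ℝ) + 1)) Filter.atTop (nhds (s + 0)) :=
      tendsto_const_nhds.add tendsto_one_div_add_atTop_nhds_zero_nat
    rw [add_zero] at h2
    exact (h1.tendsto s).comp h2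

lemma quasi_enn (ν : ℝ) {a χ : ℝ} (ha : 0 < a) (hχ : 0 ≤ χ) (t0 t1 n0 n1 c θ : ℝ)
    (hn0 : 0 ≤ n0) (hn1 : 0 ≤ n1) (hc : c ^ 2 ≤ n0 * n1)
    (ht : (t1 - t0) ^ 2 ≤ a * (n0 + n1 - 2 * c))
    (hn : ∀ θ : ℝ, 0 ≤ (1 - θ) ^ 2 * n0 + 2 * θ * (1 - θ) * c + θ ^ 2 * n1)
    (hθ : θ ∈ Icc (0:ℝ) 1) :
    min (ENNReal.ofReal (Real.exp t0) * gigL ν a (χ + n0))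
      (ENNReal.ofReal (Real.exp t1) * gigL ν a (χ + n1)) ≤
      ENNReal.ofReal (Real.exp ((1 - θ) * t0 + θ * t1)) *
        gigL ν a (χ + ((1 - θ) ^ 2 * n0 + 2 * θ * (1 - θ) * c + θ ^ 2 * n1)) := by
  have T : ∀ t s, Filter.Tendsto (fun n : ℕ => ENNReal.ofReal (Real.exp t) *
      gigL ν a (s + 1 / ((n : ℝ) + 1)))
    Filter.atTop (nhds (ENNReal.ofReal (Real.exp t) * gigL ν a s)) := fun t s =>
    ENNReal.Tendsto.const_mul (gigL_tendsto ν a s) (Or.inr ENNReal.ofReal_ne_top)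
  refine le_of_tendsto_of_tendsto' ((T t0 (χ + n0)).min (T t1 (χ + n1))) (T _ _) ?_
  intro n
  have hpos : 0 < χ + 1 / ((n : ℝ) + 1) := by positivity
  have := quasi_scalar ν ha hpos t0 t1 n0 n1 c θ hn0 hn1 hc ht hn hθ
  have hθn := hn θ
  rw [gigL_eq ν ha (by linarith), gigL_eq ν ha (by linarith), gigL_eq ν ha (by linarith)]
  rw [add_right_comm χ n0, add_right_comm χ n1, add_right_comm χ (_ + _)]
  rcases min_le_iff.1 this with h | h
  · exact (min_le_left _ _).trans (ENNReal.ofReal_le_ofReal (Real.exp_le_exp.2 h))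
  · exact (min_le_right _ _).trans (ENNReal.ofReal_le_ofReal (Real.exp_le_exp.2 h))

lemma dens_eq (P lam χ ψ n t nb : ℝ) (N : ℝ → ℝ) (hN : ∀ x, N x = n - 2 * x * t + x ^ 2 * nb) :
    ∫⁻ x in Ioi (0:ℝ), ENNReal.ofReal
      ((2 * π * x) ^ (-P/2) * Real.exp (-(N x) / (2 * x)) *
        (x ^ (lam - 1) * Real.exp (-(χ / x + ψ * x) / 2))) =
    ENNReal.ofReal ((2 * π) ^ (-P/2)) * (ENNReal.ofReal (Real.exp t) *
      gigL (lam - P / 2) (ψ + nb) (χ + n)) := by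
  have himg : Real.exp '' univ = Ioi (0:ℝ) := by rw [image_univ, Real.range_exp]
  rw [← himg, lintegral_image_eq_lintegral_abs_deriv_mul MeasurableSet.univ
    (fun x _ => (Real.hasDerivAt_exp x).hasDerivWithinAt) Real.exp_injective.injOn,
    Measure.restrict_univ, gigL, ← lintegral_const_mul' _ _ ENNReal.ofReal_ne_top,
    ← lintegral_const_mul' _ _ ENNReal.ofReal_ne_top]
  refine lintegral_congr fun u => ?_
  rw [← ENNReal.ofReal_mul (abs_nonneg _), ← ENNReal.ofReal_mul (Real.exp_pos _).le,
    ← ENNReal.ofReal_mul (by positivity)]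
  congr 1
  rw [Real.mul_rpow (by positivity) (Real.exp_pos u).le, ← Real.exp_mul, ← Real.exp_mul, abs_of_pos (Real.exp_pos u),
    hN, gigG]
  have e : ∀ A B C D E F : ℝ, Real.exp A * (F * Real.exp B * Real.exp C * (Real.exp D * Real.exp E)) =
      F * Real.exp (A + B + C + D + E) := by
    intro A B C D E F; simp only [Real.exp_add]; ring
  rw [e, ← Real.exp_add]
  congr 2
  rw [Real.exp_neg]
  have := Real.exp_pos u
  generalize Real.exp u = X at *
  field_simp
  ring

/-- Corollary 2(i): the multivariate generalized hyperbolic density (a multivariate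
normal variance-mean mixture with generalized inverse Gaussian mixing density) has
convex contours: all its superlevel sets are convex. -/
theorem multivariate_generalized_hyperbolic_convex_contours
    (p : ℕ) (hp : 1 ≤ p)
    (μ β : Fin p → ℝ)
    (A : Matrix (Fin p) (Fin p) ℝ) (hA : IsUnit A.det)
    (lam χ ψ : ℝ)
    (hlam_pos : 0 < lam → 0 ≤ χ ∧ 0 < ψ)
    (hlam_zero : lam = 0 → 0 < χ ∧ 0 < ψ)
    (hlam_neg : lam < 0 → 0 < χ ∧ 0 ≤ ψ)
    (hconv : 0 < ψ + ∑ i, (A⁻¹.mulVec β i) ^ 2 ∨ lam < (p:ℝ)/2)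
    (f : (Fin p → ℝ) → ℝ≥0∞)
    (hf : ∀ y, f y = ENNReal.ofReal |A.det|⁻¹ * ∫⁻ x in Ioi (0:ℝ), ENNReal.ofReal
      ((2 * π * x) ^ (-(p:ℝ)/2) *
        Real.exp (-(∑ i, (A⁻¹.mulVec (y - μ - x • β) i) ^ 2) / (2 * x)) *
        (x ^ (lam - 1) * Real.exp (-(χ / x + ψ * x) / 2)))) :
    ∀ c : ℝ, Convex ℝ {y : Fin p → ℝ | ENNReal.ofReal c ≤ f y} := by
  have hχ : 0 ≤ χ := by
    rcases lt_trichotomy lam 0 with h | h | h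
    · exact (hlam_neg h).1.le
    · exact (hlam_zero h).1.le
    · exact (hlam_pos h).1
  have hψ : 0 ≤ ψ := by
    rcases lt_trichotomy lam 0 with h | h | h
    · exact (hlam_neg h).2
    · exact (hlam_zero h).2.le
    · exact (hlam_pos h).2.le
  set b : Fin p → ℝ := A⁻¹.mulVec β with hb
  set z : (Fin p → ℝ) → Fin p → ℝ := fun y => A⁻¹.mulVec (y - μ) with hz
  set nb := ∑ i, b i ^ 2 with hnb
  have hnb0 : 0 ≤ nb := Finset.sum_nonneg fun i _ => sq_nonneg _
  have hf2 : ∀ y, f y = ENNReal.ofReal |A.det|⁻¹ * (ENNReal.ofReal ((2 * π) ^ (-(p:ℝ)/2)) *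
      (ENNReal.ofReal (Real.exp (∑ i, z y i * b i)) *
      gigL (lam - (p:ℝ) / 2) (ψ + nb) (χ + ∑ i, z y i ^ 2))) := by
    intro y
    rw [hf, dens_eq (p:ℝ) lam χ ψ (∑ i, z y i ^ 2) (∑ i, z y i * b i) nb]
    intro x
    rw [Matrix.mulVec_sub, Matrix.mulVec_smul, hnb, Finset.mul_sum, Finset.mul_sum,
      ← Finset.sum_sub_distrib, ← Finset.sum_add_distrib]
    refine Finset.sum_congr rfl fun i _ => ?_
    simp only [Pi.sub_apply, Pi.smul_apply, smul_eq_mul, ← hb, hz]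
    ring
  intro c y0 h0 y1 h1 w θ hw hθ hwθ
  simp only [mem_ofPred_eq] at h0 h1 ⊢
  obtain rfl : w = 1 - θ := by linarith
  have hzθ : ∀ i, z ((1 - θ) • y0 + θ • y1) i = (1 - θ) * z y0 i + θ * z y1 i := by
    intro i
    have e : (1 - θ) • y0 + θ • y1 - μ = (1 - θ) • (y0 - μ) + θ • (y1 - μ) := by
      ext j; simp; ring
    simp only [hz]
    rw [e, Matrix.mulVec_add, Matrix.mulVec_smul, Matrix.mulVec_smul]
    simp
  have key : ∀ θ : ℝ, ∑ i, ((1 - θ) * z y0 i + θ * z y1 i) ^ 2 =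
      (1 - θ) ^ 2 * (∑ i, z y0 i ^ 2) + 2 * θ * (1 - θ) * (∑ i, z y0 i * z y1 i) +
        θ ^ 2 * ∑ i, z y1 i ^ 2 := by
    intro θ
    rw [Finset.mul_sum, Finset.mul_sum, Finset.mul_sum, ← Finset.sum_add_distrib,
      ← Finset.sum_add_distrib]
    exact Finset.sum_congr rfl fun i _ => by ring
  have key2 : ∑ i, z ((1 - θ) • y0 + θ • y1) i * b i =
      (1 - θ) * (∑ i, z y0 i * b i) + θ * ∑ i, z y1 i * b i := by
    rw [Finset.mul_sum, Finset.mul_sum, ← Finset.sum_add_distrib]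
    exact Finset.sum_congr rfl fun i _ => by rw [hzθ]; ring
  have key3 : ∑ i, z ((1 - θ) • y0 + θ • y1) i ^ 2 = ∑ i, ((1 - θ) * z y0 i + θ * z y1 i) ^ 2 :=
    Finset.sum_congr rfl fun i _ => by rw [hzθ]
  have hn : ∀ θ : ℝ, 0 ≤ (1 - θ) ^ 2 * (∑ i, z y0 i ^ 2) +
      2 * θ * (1 - θ) * (∑ i, z y0 i * z y1 i) + θ ^ 2 * ∑ i, z y1 i ^ 2 := by
    intro θ; rw [← key]; exact Finset.sum_nonneg fun i _ => sq_nonneg _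
  have hd : ∑ i, (z y1 i - z y0 i) ^ 2 =
      ∑ i, z y0 i ^ 2 + ∑ i, z y1 i ^ 2 - 2 * ∑ i, z y0 i * z y1 i := by
    rw [Finset.mul_sum, ← Finset.sum_add_distrib, ← Finset.sum_sub_distrib]
    exact Finset.sum_congr rfl fun i _ => by ring
  have hd0 : 0 ≤ ∑ i, (z y1 i - z y0 i) ^ 2 := Finset.sum_nonneg fun i _ => sq_nonneg _
  have hcs := Finset.sum_mul_sq_le_sq_mul_sq Finset.univ (z y0) (z y1)
  have hcs2 := Finset.sum_mul_sq_le_sq_mul_sq Finset.univ (fun i => z y1 i - z y0 i) b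
  have hn0 : 0 ≤ ∑ i, z y0 i ^ 2 := Finset.sum_nonneg fun i _ => sq_nonneg _
  have hn1 : 0 ≤ ∑ i, z y1 i ^ 2 := Finset.sum_nonneg fun i _ => sq_nonneg _
  have main : min (f y0) (f y1) ≤ f ((1 - θ) • y0 + θ • y1) := by
    rw [hf2 y0, hf2 y1, hf2 ((1 - θ) • y0 + θ • y1), key2, key3, key]
    suffices hs : min (ENNReal.ofReal (Real.exp (∑ i, z y0 i * b i)) *
        gigL (lam - (p:ℝ) / 2) (ψ + nb) (χ + ∑ i, z y0 i ^ 2))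
        (ENNReal.ofReal (Real.exp (∑ i, z y1 i * b i)) *
        gigL (lam - (p:ℝ) / 2) (ψ + nb) (χ + ∑ i, z y1 i ^ 2)) ≤ _ by
      rcases min_le_iff.1 hs with h | h
      · exact (min_le_left _ _).trans (by gcongr)
      · exact (min_le_right _ _).trans (by gcongr)
    rcases hnb0.eq_or_lt with h | h
    · have hb0 : ∀ i, b i = 0 := by
        have := (Finset.sum_eq_zero_iff_of_nonneg (fun i _ => sq_nonneg (b i))).1 h.symm
        intro i
        exact pow_eq_zero_iff (two_ne_zero) |>.1 (this i (Finset.mem_univ i))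
      simp only [hb0, mul_zero, Finset.sum_const_zero, add_zero, Real.exp_zero, ENNReal.ofReal_one,
        one_mul]
      have hle : (1 - θ) ^ 2 * (∑ i, z y0 i ^ 2) +
          2 * θ * (1 - θ) * (∑ i, z y0 i * z y1 i) + θ ^ 2 * ∑ i, z y1 i ^ 2 ≤
          (1 - θ) * (∑ i, z y0 i ^ 2) + θ * ∑ i, z y1 i ^ 2 := by
        rw [hd] at hd0
        have := mul_nonneg (mul_nonneg hw hθ) hd0
        nlinarith
      rcases le_total (∑ i, z y0 i ^ 2) (∑ i, z y1 i ^ 2) with h | h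
      · refine (min_le_right _ _).trans (gigL_anti _ _ ?_)
        have := mul_le_mul_of_nonneg_left h hw
        linarith
      · refine (min_le_left _ _).trans (gigL_anti _ _ ?_)
        have := mul_le_mul_of_nonneg_left h hθ
        linarith
    · refine quasi_enn _ (by linarith) hχ _ _ _ _ _ θ hn0 hn1 hcs ?_ hn ⟨hθ, by linarith⟩
      rw [← hd]
      have e : ∑ i, z y1 i * b i - ∑ i, z y0 i * b i = ∑ i, (z y1 i - z y0 i) * b i := by
        rw [← Finset.sum_sub_distrib]
        exact Finset.sum_congr rfl fun i _ => by ring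
      rw [e]
      refine hcs2.trans ?_
      rw [mul_comm]
      exact mul_le_mul_of_nonneg_right (by linarith) hd0
  exact (le_min h0 h1).trans main
end

section
/- Let p ≥ 1, let μ, β be vectors in ℝ^p, let A be an invertible p×p real matrix, and let λ, χ, ψ ∈ ℝ satisfy: (χ ≥ 0 and ψ > 0) if λ > 0; (χ > 0 and ψ > 0) if λ = 0; (χ > 0 and ψ ≥ 0) if λ < 0. Define f : ℝ^p → [0,∞] by f(y) = |det A|^{-1} ∫₀^∞ (2πx)^{-p/2} · exp(−‖A⁻¹(y − μ − xβ)‖²/(2x)) · x^{λ−1} exp(−(χ/x + ψx)/2) dx. Then f is log-concave on ℝ^p if and only if λ ≥ (p+1)/2. -/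
open MeasureTheory Set Real ENNReal

noncomputable def ghW (c a s x : ℝ) : ℝ := x ^ (a - 1) * Real.exp (-s / (2 * x) - c * x / 2)

noncomputable def ghH (c a s : ℝ) : ℝ := ∫ x in Ioi (0:ℝ), ghW c a s x

def ghP (c a : ℝ) : Prop := 0 < c ∨ (c = 0 ∧ a < 0)

lemma ghP_nonneg {c a : ℝ} (h : ghP c a) : 0 ≤ c := by
  rcases h with h | h
  · exact h.le
  · exact h.1.ge

lemma ghP_sub {c a b : ℝ} (h : ghP c a) (hb : b ≤ a) : ghP c b := by
  rcases h with h | h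
  · exact Or.inl h
  · exact Or.inr ⟨h.1, by linarith [h.2]⟩

lemma ghW_pos {c a s x : ℝ} (hx : 0 < x) : 0 < ghW c a s x := by
  unfold ghW; positivity

lemma ghW_meas (c a s : ℝ) : Measurable (ghW c a s) := by
  unfold ghW; fun_prop

lemma ghW_anti {c a s s' x : ℝ} (hx : 0 < x) (h : s ≤ s') : ghW c a s' x ≤ ghW c a s x := by
  unfold ghW
  apply mul_le_mul_of_nonneg_left _ (by positivity)
  apply Real.exp_le_exp.2
  have : -s' / (2 * x) ≤ -s / (2 * x) := by
    apply div_le_div_of_nonneg_right _ (by positivity); linarith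
  linarith

lemma ghW_shift {c a s x : ℝ} (hx : 0 < x) : ghW c (a - 1) s x = ghW c a s x / x := by
  unfold ghW
  rw [Real.rpow_sub_one hx.ne' (a - 1)]; ring

lemma ghW_bound (c a : ℝ) {s : ℝ} (hs : 0 < s) (n : ℕ) :
    ∃ K : ℝ, 0 ≤ K ∧ ∀ x, 0 < x → ghW c a s x ≤ K * (x ^ (a - 1 + n) * Real.exp (-(c / 2) * x)) := by
  refine ⟨n.factorial * (2 / s) ^ n, by positivity, fun x hx => ?_⟩
  unfold ghW
  have h1 := Real.pow_div_factorial_le_exp (s / (2 * x)) (by positivity) n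
  have h2 : Real.exp (-s / (2 * x)) ≤ n.factorial * (2 / s) ^ n * x ^ n := by
    rw [neg_div, Real.exp_neg]
    rw [inv_le_comm₀ (Real.exp_pos _) (by positivity)]
    refine le_trans (le_of_eq ?_) h1
    have : (s / (2 * x)) ^ n = ((2 / s) ^ n * x ^ n)⁻¹ := by
      rw [← mul_pow, ← inv_pow]; congr 1; field_simp
    rw [this]; field_simp
  have h3 : -s / (2 * x) - c * x / 2 = -s / (2 * x) + (-(c / 2) * x) := by ring
  rw [h3, Real.exp_add, Real.rpow_add hx, Real.rpow_natCast]
  calc _ = (x ^ (a - 1) * Real.exp (-(c / 2) * x)) * Real.exp (-s / (2 * x)) := by ring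
    _ ≤ (x ^ (a - 1) * Real.exp (-(c / 2) * x)) * (n.factorial * (2 / s) ^ n * x ^ n) :=
        mul_le_mul_of_nonneg_left h2 (by positivity)
    _ = _ := by ring

lemma gamma_int {b d : ℝ} (hb : -1 < b) (hd : 0 < d) :
    IntegrableOn (fun x : ℝ => x ^ b * Real.exp (-d * x)) (Ioi 0) := by
  have := integrableOn_rpow_mul_exp_neg_mul_rpow (p := 1) hb one_pos hd
  simpa using this

lemma ghW_int {c a s : ℝ} (h : ghP c a) (hs : 0 < s) : IntegrableOn (ghW c a s) (Ioi 0) := by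
  have key : ∀ (t : Set ℝ) (g : ℝ → ℝ), MeasurableSet t → t ⊆ Ioi 0 → IntegrableOn g t →
      (∀ x ∈ t, ghW c a s x ≤ g x) → IntegrableOn (ghW c a s) t := by
    intro t g ht hsub hg hle
    refine Integrable.mono' hg (ghW_meas c a s).aestronglyMeasurable ?_
    filter_upwards [ae_restrict_mem ht] with x hx
    rw [Real.norm_of_nonneg (ghW_pos (hsub hx)).le]
    exact hle x hx
  obtain ⟨n, hn⟩ := exists_nat_gt (-a + 1)
  obtain ⟨K, hK, hb⟩ := ghW_bound c a hs n
  rcases h with hc | ⟨hc, ha⟩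
  · refine key _ _ measurableSet_Ioi subset_rfl
      ((gamma_int (b := a - 1 + n) (d := c / 2) (by linarith) (by linarith)).const_mul K) ?_
    exact fun x hx => hb x hx
  · subst hc
    rw [← Ioc_union_Ioi_eq_Ioi (zero_le_one (α := ℝ))]
    refine IntegrableOn.union ?_ ?_
    · refine key _ (fun _ => K) measurableSet_Ioc (fun x hx => hx.1) (by simp) ?_
      intro x hx
      refine (hb x hx.1).trans ?_
      have : x ^ (a - 1 + n) ≤ 1 := Real.rpow_le_one hx.1.le hx.2 (by linarith)
      simp
      nlinarith
    · refine key _ (fun x => x ^ (a - 1)) measurableSet_Ioi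
        (fun x hx => lt_trans (zero_lt_one (α := ℝ)) hx) (integrableOn_Ioi_rpow_of_lt (by linarith) one_pos) ?_
      intro x hx
      have hx0 : 0 < x := lt_trans (zero_lt_one (α := ℝ)) hx
      unfold ghW
      have : Real.exp (-s / (2 * x) - 0 * x / 2) ≤ 1 := by
        rw [Real.exp_le_one_iff, neg_div]
        have : 0 < s / (2 * x) := by positivity
        linarith
      exact mul_le_of_le_one_right (by positivity) this

lemma ghW_int0 {c a : ℝ} (hc : 0 < c) (ha : 0 < a) : IntegrableOn (ghW c a 0) (Ioi 0) := by
  have := gamma_int (b := a - 1) (d := c / 2) (by linarith) (by linarith)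
  refine this.congr_fun ?_ measurableSet_Ioi
  intro x hx
  unfold ghW
  simp only
  congr 2
  ring

lemma ghH_pos_of {c a s : ℝ} (hi : IntegrableOn (ghW c a s) (Ioi 0)) : 0 < ghH c a s := by
  unfold ghH
  rw [setIntegral_pos_iff_support_of_nonneg_ae _ hi]
  · have : Function.support (ghW c a s) ∩ Ioi 0 = Ioi 0 := by
      apply inter_eq_right.2
      intro x hx
      exact (ghW_pos hx).ne'
    rw [this]; simp
  · filter_upwards [ae_restrict_mem measurableSet_Ioi] with x hx
    exact (ghW_pos hx).le

lemma ghH_pos {c a s : ℝ} (h : ghP c a) (hs : 0 < s) : 0 < ghH c a s := ghH_pos_of (ghW_int h hs)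

lemma ghH_anti {c a s s' : ℝ} (hi : IntegrableOn (ghW c a s) (Ioi 0)) 
    (hi' : IntegrableOn (ghW c a s') (Ioi 0)) (h : s ≤ s') : ghH c a s' ≤ ghH c a s := by
  refine setIntegral_mono_on hi' hi measurableSet_Ioi fun x hx => ghW_anti hx h

lemma ghH_deriv {c a s : ℝ} (h : ghP c a) (hs : 0 < s) :
    HasDerivAt (ghH c a) (-(1 / 2) * ghH c (a - 1) s) s := by
  have h' : ghP c (a - 1) := ghP_sub h (by linarith)
  have := hasDerivAt_integral_of_dominated_loc_of_deriv_le (μ := volume.restrict (Ioi (0:ℝ)))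
    (F := fun s x => ghW c a s x) (F' := fun s x => -(1/2) * ghW c (a - 1) s x) (x₀ := s)
    (s := Ioi (s / 2)) (bound := fun x => (1/2) * ghW c (a - 1) (s / 2) x)
    (Ioi_mem_nhds (by linarith))
    (Filter.Eventually.of_forall fun s => (ghW_meas c a s).aestronglyMeasurable)
    (ghW_int h hs) ((ghW_meas c (a-1) s).aestronglyMeasurable.const_mul _)
    (by
      filter_upwards [ae_restrict_mem measurableSet_Ioi] with x hx y hy
      rw [norm_mul, Real.norm_of_nonneg (ghW_pos hx).le]
      have := ghW_anti (c := c) (a := a - 1) hx (le_of_lt hy)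
      norm_num
      linarith)
    ((ghW_int h' (by linarith)).const_mul _)
    (by
      filter_upwards [ae_restrict_mem measurableSet_Ioi] with x hx y hy
      have hx' : 0 < x := hx
      rw [ghW_shift hx]
      unfold ghW
      have h1 : HasDerivAt (fun y : ℝ => -y / (2 * x) - c * x / 2) (-1 / (2 * x)) y :=
        (((hasDerivAt_id y).neg).div_const _).sub_const _
      refine (h1.exp.const_mul (x ^ (a - 1))).congr_deriv ?_
      field_simp)
  have h2 := this.2
  rw [integral_const_mul] at h2
  exact h2

lemma gh_lin {c a s : ℝ} (h : ghP c a) (hs : 0 < s) (u v w : ℝ) :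
    ∫ x in Ioi (0:ℝ), (u * ghW c a s x + v * ghW c (a - 1) s x + w * ghW c (a - 1 - 1) s x)
      = u * ghH c a s + v * ghH c (a - 1) s + w * ghH c (a - 1 - 1) s := by
  have i0 := (ghW_int h hs).const_mul u
  have i1 := (ghW_int (ghP_sub h (b := a - 1) (by linarith)) hs).const_mul v
  have i2 := (ghW_int (ghP_sub h (b := a - 1 - 1) (by linarith)) hs).const_mul w
  have i01 : IntegrableOn (fun x => u * ghW c a s x + v * ghW c (a - 1) s x) (Ioi 0) := i0.add i1
  rw [integral_add i01 i2, integral_add i0 i1, integral_const_mul, integral_const_mul,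
    integral_const_mul]
  rfl

lemma ghH_rec {c a s : ℝ} (h : ghP c a) (hs : 0 < s) :
    s * ghH c (a - 1 - 1) s = c * ghH c a s - 2 * (a - 1) * ghH c (a - 1) s := by
  have h1 : ghP c (a - 1) := ghP_sub h (by linarith)
  have h2 : ghP c (a - 1 - 1) := ghP_sub h (by linarith)
  have i0 := ghW_int h hs
  have i1 := ghW_int h1 hs
  have i2 := ghW_int h2 hs
  set F : ℝ → ℝ := fun x => if x ≤ 0 then 0 else ghW c a s x with hF
  set F' : ℝ → ℝ := fun x => (a - 1) * ghW c (a - 1) s x + s / 2 * ghW c (a - 1 - 1) s x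
    - c / 2 * ghW c a s x with hF'
  have hd : ∀ x ∈ Ioi (0:ℝ), HasDerivAt F (F' x) x := by
    intro x hx
    have hx' : 0 < x := hx
    have e : F =ᶠ[nhds x] ghW c a s := by
      filter_upwards [Ioi_mem_nhds hx'] with y hy
      simp [hF, not_le.2 (mem_Ioi.1 hy)]
    refine HasDerivAt.congr_of_eventuallyEq ?_ e
    have d1 : HasDerivAt (fun x : ℝ => x ^ (a - 1)) ((a - 1) * x ^ (a - 1 - 1)) x :=
      Real.hasDerivAt_rpow_const (Or.inl hx'.ne')
    have d2 : HasDerivAt (fun x : ℝ => -s / (2 * x) - c * x / 2) (s / (2 * x ^ 2) - c / 2) x := by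
      have e1 : HasDerivAt (fun x : ℝ => 2 * x) 2 x := by simpa using (hasDerivAt_id x).const_mul 2
      have e2 := (hasDerivAt_const x (-s)).div e1 (by positivity)
      have e3 : HasDerivAt (fun x : ℝ => c * x / 2) (c / 2) x := by
        simpa using ((hasDerivAt_id x).const_mul c).div_const 2
      refine (e2.sub e3).congr_deriv ?_
      field_simp
      ring
    have d3 := d1.mul d2.exp
    refine d3.congr_deriv ?_
    simp only [hF']
    rw [ghW_shift (a := a - 1) hx, ghW_shift hx]
    unfold ghW
    rw [Real.rpow_sub_one hx'.ne' (a - 1)]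
    field_simp
    ring
  have hi' : IntegrableOn F' (Ioi 0) := ((i1.const_mul _).add (i2.const_mul _)).sub (i0.const_mul _)
  have hi : IntegrableOn F (Ioi 0) := by
    refine i0.congr_fun ?_ measurableSet_Ioi
    intro x hx
    simp [hF, not_le.2 (mem_Ioi.1 hx)]
  have ht := tendsto_zero_of_hasDerivAt_of_integrableOn_Ioi hd hi' hi
  have hcont : ContinuousWithinAt F (Ici 0) 0 := by
    obtain ⟨n, hn⟩ := exists_nat_gt (-a + 2)
    obtain ⟨K, hK, hb⟩ := ghW_bound c a hs n
    have hm : 0 < a - 1 + n := by linarith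
    have hF0 : F 0 = 0 := by simp [hF]
    unfold ContinuousWithinAt
    rw [hF0]
    have hlim : Filter.Tendsto (fun x : ℝ => K * (x ^ (a - 1 + n) * Real.exp (-(c / 2) * x)))
        (nhdsWithin 0 (Ici 0)) (nhds 0) := by
      have : ContinuousAt (fun x : ℝ => K * (x ^ (a - 1 + n) * Real.exp (-(c / 2) * x))) 0 := by
        have := Real.continuousAt_rpow_const 0 (a - 1 + n) (Or.inr hm.le)
        fun_prop
      have h3 := this.tendsto
      simp [Real.zero_rpow hm.ne'] at h3
      simpa using h3.mono_left nhdsWithin_le_nhds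
    refine squeeze_zero' ?_ ?_ hlim
    · filter_upwards with x
      simp only [hF]
      split_ifs with hx
      · exact le_rfl
      · exact (ghW_pos (not_le.1 hx)).le
    · filter_upwards [self_mem_nhdsWithin] with x hx
      simp only [hF]
      split_ifs with hx'
      · have : 0 ≤ x := hx
        positivity
      · exact hb x (not_le.1 hx')
  have hfin := integral_Ioi_of_hasDerivAt_of_tendsto hcont hd hi' ht
  have hF0 : F 0 = 0 := by simp [hF]
  rw [hF0] at hfin
  have e : ∀ x, F' x = (-(c / 2)) * ghW c a s x + (a - 1) * ghW c (a - 1) s x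
      + s / 2 * ghW c (a - 1 - 1) s x := fun x => by simp only [hF']; ring
  simp only [e] at hfin
  rw [gh_lin h hs] at hfin
  linarith

lemma ghH_cs {c a s : ℝ} (h : ghP c a) (hs : 0 < s) :
    ghH c (a - 1) s ^ 2 ≤ ghH c a s * ghH c (a - 1 - 1) s := by
  have h1 : ghP c (a - 1) := ghP_sub h (by linarith)
  have h2 : ghP c (a - 1 - 1) := ghP_sub h (by linarith)
  have i0 := ghW_int h hs
  have i1 := ghW_int h1 hs
  have i2 := ghW_int h2 hs
  have p0 := ghH_pos h hs
  set A := ghH c (a - 1) s with hA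
  set B := ghH c a s with hB
  have hnn : 0 ≤ ∫ x in Ioi (0:ℝ), (A ^ 2 * ghW c a s x + (-(2 * A * B)) * ghW c (a - 1) s x
      + B ^ 2 * ghW c (a - 1 - 1) s x) := by
    refine setIntegral_nonneg measurableSet_Ioi fun x hx => ?_
    have hx' : 0 < x := hx
    rw [ghW_shift (a := a - 1) hx, ghW_shift hx]
    have := ghW_pos (c := c) (a := a) (s := s) hx
    have e : A ^ 2 * ghW c a s x + (-(2 * A * B)) * (ghW c a s x / x) + B ^ 2 * (ghW c a s x / x / x)
      = ghW c a s x * (A - B / x) ^ 2 := by field_simp; ring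
    rw [e]; positivity
  rw [gh_lin h hs] at hnn
  rw [← hA, ← hB] at hnn
  have : 0 ≤ B * (B * ghH c (a - 1 - 1) s - A ^ 2) := by linarith
  have := nonneg_of_mul_nonneg_right this p0
  linarith

noncomputable def ghL (c a χ t : ℝ) : ℝ := t * (ghH c (a - 1) (χ + t ^ 2) / ghH c a (χ + t ^ 2))

lemma ghL_pos {c a χ t : ℝ} (h : ghP c a) (hχ : 0 ≤ χ) (ht : 0 < t) : 0 < ghL c a χ t := by
  have := ghH_pos h (s := χ + t ^ 2) (by positivity)
  have := ghH_pos (ghP_sub h (b := a - 1) (by linarith)) (s := χ + t ^ 2) (by positivity)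
  unfold ghL; positivity

lemma gh_comp_deriv {c a χ t : ℝ} (h : ghP c a) (hχ : 0 ≤ χ) (ht : 0 < t) :
    HasDerivAt (fun t => ghH c a (χ + t ^ 2)) (-t * ghH c (a - 1) (χ + t ^ 2)) t := by
  have h1 := ghH_deriv h (s := χ + t ^ 2) (by positivity)
  have h2 : HasDerivAt (fun t : ℝ => χ + t ^ 2) (2 * t) t := by
    simpa using (hasDerivAt_pow 2 t).const_add χ
  have h3 := h1.comp t h2
  refine h3.congr_deriv ?_
  ring

lemma gh_log_deriv {c a χ t : ℝ} (h : ghP c a) (hχ : 0 ≤ χ) (ht : 0 < t) :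
    HasDerivAt (fun t => Real.log (ghH c a (χ + t ^ 2))) (-ghL c a χ t) t := by
  have p0 := ghH_pos h (s := χ + t ^ 2) (by positivity)
  refine ((gh_comp_deriv h hχ ht).log p0.ne').congr_deriv ?_
  unfold ghL; ring

lemma ghL_deriv {c a χ t : ℝ} (h : ghP c a) (hχ : 0 ≤ χ) (ht : 0 < t) :
    HasDerivAt (ghL c a χ) (ghL c a χ t / t + ghL c a χ t ^ 2
      + (t ^ 2 / (χ + t ^ 2)) * (2 * (a - 1) * (ghL c a χ t / t) - c)) t := by
  have h1 : ghP c (a - 1) := ghP_sub h (by linarith)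
  have hs : 0 < χ + t ^ 2 := by positivity
  have p0 := ghH_pos h hs
  have d := (hasDerivAt_id t).mul ((gh_comp_deriv h1 hχ ht).div (gh_comp_deriv h hχ ht) p0.ne')
  unfold ghL
  refine HasDerivAt.congr_deriv d ?_
  have hr := ghH_rec h hs
  simp only [id, Pi.div_apply]
  set B := ghH c a (χ + t ^ 2)
  set A := ghH c (a - 1) (χ + t ^ 2)
  have : ghH c (a - 1 - 1) (χ + t ^ 2) = (c * B - 2 * (a - 1) * A) / (χ + t ^ 2) := by
    rw [eq_div_iff hs.ne']; linarith
  rw [this]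
  field_simp
  ring

lemma ghL_deriv0 {c a t : ℝ} (h : ghP c a) (ht : 0 < t) :
    HasDerivAt (ghL c a 0) (ghL c a 0 t ^ 2 + (2 * a - 1) * ghL c a 0 t / t - c) t := by
  refine (ghL_deriv h le_rfl ht).congr_deriv ?_
  field_simp
  ring

lemma ghL_deriv0_nonneg {c a t : ℝ} (h : ghP c a) (ha : 1 / 2 ≤ a) (ht : 0 < t) :
    0 ≤ ghL c a 0 t ^ 2 + (2 * a - 1) * ghL c a 0 t / t - c := by
  by_contra! hneg
  set L0 := ghL c a 0 t with hL0
  have hL0p : 0 < L0 := ghL_pos h le_rfl ht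
  obtain ⟨δ, hδ⟩ : ∃ δ, δ = -(L0 ^ 2 + (2 * a - 1) * L0 / t - c) / 2 := ⟨_, rfl⟩
  have hδp : 0 < δ := by rw [hδ]; linarith
  have key := image_le_of_deriv_right_lt_deriv_boundary (f := ghL c a 0)
    (f' := fun t => ghL c a 0 t ^ 2 + (2 * a - 1) * ghL c a 0 t / t - c)
    (a := t) (b := t + L0 / δ) (B := fun x => L0 - δ * (x - t)) (B' := fun _ => -δ)
    (fun x hx => (ghL_deriv0 h (lt_of_lt_of_le ht hx.1)).continuousAt.continuousWithinAt)
    (fun x hx => (ghL_deriv0 h (lt_of_lt_of_le ht hx.1)).hasDerivWithinAt)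
    (by simp [hL0])
    (fun x => by
      have := (((hasDerivAt_id x).sub_const t).const_mul δ).const_sub L0
      simpa using this)
    (fun x hx hxe => by
      have hx0 : 0 < x := lt_of_lt_of_le ht hx.1
      have hLp : 0 < ghL c a 0 x := ghL_pos h le_rfl hx0
      have hle : ghL c a 0 x ≤ L0 := by
        rw [hxe]; nlinarith [hx.1]
      have e1 : ghL c a 0 x ^ 2 ≤ L0 ^ 2 := by gcongr
      have e2 : (2 * a - 1) * ghL c a 0 x / x ≤ (2 * a - 1) * L0 / t := by
        have : 0 ≤ 2 * a - 1 := by linarith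
        have := hx.1
        gcongr
      linarith)
  have hq : 0 < L0 / δ := by positivity
  have := key (x := t + L0 / δ) ⟨by linarith, le_rfl⟩
  have hp := ghL_pos (c := c) (a := a) h le_rfl (t := t + L0 / δ) (by linarith)
  have e : L0 - δ * (t + L0 / δ - t) = 0 := by field_simp; ring
  simp only [e] at this
  linarith

lemma gh_int_all {c a s : ℝ} (hc : 0 < c) (ha : 0 < a) (hs : 0 ≤ s) :
    IntegrableOn (ghW c a s) (Ioi 0) := by
  rcases hs.eq_or_lt with h | h
  · rw [← h]; exact ghW_int0 hc ha
  · exact ghW_int (Or.inl hc) h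

lemma gh_concave {c a : ℝ} (hc : 0 < c) (ha : 1 / 2 ≤ a) :
    ConcaveOn ℝ (Ici 0) (fun t => Real.log (ghH c a (0 + t ^ 2))) := by
  have h : ghP c a := Or.inl hc
  have hd : ∀ t, 0 < t → HasDerivAt (fun t => Real.log (ghH c a (0 + t ^ 2))) (-ghL c a 0 t) t :=
    fun t ht => gh_log_deriv h le_rfl ht
  have hmono : MonotoneOn (ghL c a 0) (Ioi 0) := by
    refine monotoneOn_of_deriv_nonneg (convex_Ioi 0) ?_ ?_ ?_
    · exact fun x hx => (ghL_deriv0 h hx).continuousAt.continuousWithinAt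
    · rw [interior_Ioi]
      exact fun x hx => (ghL_deriv0 h hx).differentiableAt.differentiableWithinAt
    · rw [interior_Ioi]
      intro x hx
      rw [(ghL_deriv0 h hx).deriv]
      exact ghL_deriv0_nonneg h ha hx
  refine AntitoneOn.concaveOn_of_deriv (convex_Ici 0) ?_ ?_ ?_
  · intro t ht
    rcases (mem_Ici.1 ht).eq_or_lt with h0 | h0
    · subst h0
      have hpos := ghH_pos_of (gh_int_all hc (a := a) (s := 0 + 0 ^ 2) (by linarith) (by norm_num))
      refine ContinuousWithinAt.log ?_ hpos.ne'
      unfold ghH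
      refine continuousWithinAt_of_dominated (bound := ghW c a 0) ?_ ?_ (ghW_int0 hc (by linarith)) ?_
      · exact Filter.Eventually.of_forall fun s => (ghW_meas c a _).aestronglyMeasurable
      · refine Filter.Eventually.of_forall fun s => ?_
        filter_upwards [ae_restrict_mem measurableSet_Ioi] with x hx
        rw [Real.norm_of_nonneg (ghW_pos hx).le]
        exact ghW_anti hx (by positivity)
      · refine Filter.Eventually.of_forall fun x => ?_
        apply Continuous.continuousWithinAt
        unfold ghW
        fun_prop
    · exact (hd t h0).continuousAt.continuousWithinAt
  · rw [interior_Ici]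
    exact fun x hx => (hd x hx).differentiableAt.differentiableWithinAt
  · rw [interior_Ici]
    intro x hx y hy hxy
    rw [(hd x hx).deriv, (hd y hy).deriv]
    exact neg_le_neg (hmono hx hy hxy)

lemma gh_converse {c a χ : ℝ} (h : ghP c a) (hχ : 0 ≤ χ)
    (hconc : ConcaveOn ℝ (Ioi 0) (fun t => Real.log (ghH c a (χ + t ^ 2)))) : 1 / 2 ≤ a := by
  by_contra! ha
  have hc := ghP_nonneg h
  have hd : ∀ t, 0 < t → HasDerivAt (fun t => Real.log (ghH c a (χ + t ^ 2))) (-ghL c a χ t) t :=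
    fun t ht => gh_log_deriv h hχ ht
  have hmono : MonotoneOn (ghL c a χ) (Ioi 0) := by
    intro x hx y hy hxy
    have := hconc.antitoneOn_deriv (fun x hx => (hd x hx).differentiableAt) hx hy hxy
    rw [(hd x hx).deriv, (hd y hy).deriv] at this
    linarith
  have hdn : ∀ t, 0 < t → 0 ≤ ghL c a χ t / t + ghL c a χ t ^ 2
      + (t ^ 2 / (χ + t ^ 2)) * (2 * (a - 1) * (ghL c a χ t / t) - c) := by
    intro t ht
    have h1 := hmono.derivWithin_nonneg (x := t)
    rwa [((ghL_deriv h hχ ht).hasDerivWithinAt).derivWithin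
      (isOpen_Ioi.uniqueDiffWithinAt ht)] at h1
  have hub : ∀ t, 0 < t → ghL c a χ t ^ 2 ≤ c + 2 * (1 - a) * (ghL c a χ t / t) := by
    intro t ht
    have hs : 0 < χ + t ^ 2 := by positivity
    have p0 := ghH_pos h hs
    have p1 := ghH_pos (ghP_sub h (b := a - 1) (by linarith)) hs
    have hr := ghH_rec h hs
    have hcs := ghH_cs h hs
    unfold ghL
    set B := ghH c a (χ + t ^ 2)
    set A := ghH c (a - 1) (χ + t ^ 2)
    set Z := ghH c (a - 1 - 1) (χ + t ^ 2)
    have e1 : (χ + t ^ 2) * A ^ 2 ≤ B * (c * B - 2 * (a - 1) * A) := by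
      rw [← hr]; nlinarith
    have e2 : t ^ 2 * A ^ 2 ≤ B * (c * B - 2 * (a - 1) * A) := by nlinarith [sq_nonneg A]
    have e3 : (t * (A / B)) ^ 2 = t ^ 2 * A ^ 2 / B ^ 2 := by field_simp
    have e4 : c + 2 * (1 - a) * (t * (A / B) / t) = B * (c * B - 2 * (a - 1) * A) / B ^ 2 := by
      field_simp; ring
    rw [e3, e4]
    gcongr
  have hle : ∀ t, 0 < t → ghL c a χ t ≤ √c := by
    intro t ht
    by_contra! hlt
    set L0 := ghL c a χ t with hL0
    have hL0p : 0 < L0 := ghL_pos h hχ ht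
    have hsq : c < L0 ^ 2 := by
      have := Real.sq_sqrt hc
      nlinarith [Real.sqrt_nonneg c]
    -- choose u large
    obtain ⟨u, hu1, hu2⟩ : ∃ u, t ≤ u ∧ 2 * (1 - a) * L0 / (L0 ^ 2 - c) < u :=
      ⟨max t (2 * (1 - a) * L0 / (L0 ^ 2 - c) + 1), le_max_left _ _,
        lt_of_lt_of_le (lt_add_one _) (le_max_right _ _)⟩
    have hu0 : 0 < u := by linarith
    have hm := hmono ht hu0 hu1
    have hb := hub u hu0
    rw [← hL0] at hm
    set L1 := ghL c a χ u
    rw [div_lt_iff₀ (by linarith)] at hu2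
    have hb' : u * L1 ^ 2 ≤ c * u + 2 * (1 - a) * L1 := by
      have : c * u + 2 * (1 - a) * L1 = u * (c + 2 * (1 - a) * (L1 / u)) := by field_simp
      rw [this]; gcongr
    -- L1 = L0 + e
    have h3 : c * u * L0 ≤ c * u * L1 := by gcongr
    have h4 : L1 * (2 * (1 - a) * L0) < L1 * (u * (L0 ^ 2 - c)) :=
      mul_lt_mul_of_pos_left hu2 (by linarith)
    have h5 : L0 * (u * L1 ^ 2) ≤ L0 * (c * u + 2 * (1 - a) * L1) := by gcongr
    have h6 : u * L1 * L0 * L0 ≤ u * L1 * L0 * L1 := by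
      apply mul_le_mul_of_nonneg_left hm
      have : 0 < L1 := by linarith
      positivity
    nlinarith
  have hfin : ∀ t, 0 < t → (1 - 2 * a) * t ^ 2 ≤ χ * (1 + t * √c) := by
    intro t ht
    have hs : 0 < χ + t ^ 2 := by positivity
    have hp : 0 < ghL c a χ t := ghL_pos h hχ ht
    have h1 := hdn t ht
    have h2 := hle t ht
    set L := ghL c a χ t
    have h3 : L ^ 2 ≤ c := by
      have := Real.sq_sqrt hc
      nlinarith
    obtain ⟨q, hq⟩ : ∃ q, q = L / t := ⟨_, rfl⟩
    have hLq : L = t * q := by rw [hq]; field_simp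
    have hq0 : 0 < q := by rw [hq]; positivity
    rw [← hq] at h1
    have h4 : 0 ≤ (χ + t ^ 2) * (q + L ^ 2) + t ^ 2 * (2 * (a - 1) * q - c) := by
      have := mul_nonneg hs.le h1
      have e : (χ + t ^ 2) * (q + L ^ 2 + t ^ 2 / (χ + t ^ 2) * (2 * (a - 1) * q - c))
        = (χ + t ^ 2) * (q + L ^ 2) + t ^ 2 * (2 * (a - 1) * q - c) := by field_simp
      rwa [e] at this
    have h5 : (1 - 2 * a) * t ^ 2 * q ≤ χ * (q + L ^ 2) := by
      nlinarith [mul_nonneg (sq_nonneg t) (sub_nonneg.2 h3)]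
    have h6 : q + L ^ 2 = (1 + t * L) * q := by rw [hLq]; ring
    rw [h6, ← mul_assoc] at h5
    have h7 := le_of_mul_le_mul_right h5 hq0
    refine h7.trans ?_
    gcongr
  obtain ⟨t, ht1, ht2⟩ : ∃ t, 1 ≤ t ∧ χ * (1 + √c) / (1 - 2 * a) < t :=
    ⟨max 1 (χ * (1 + √c) / (1 - 2 * a) + 1), le_max_left _ _,
      lt_of_lt_of_le (lt_add_one _) (le_max_right _ _)⟩
  rw [div_lt_iff₀ (by linarith)] at ht2
  have h1 := hfin t (by linarith)
  have h2 : χ * (1 + t * √c) ≤ t * (χ * (1 + √c)) := by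
    nlinarith
  nlinarith

lemma gh_sqrt_convex {p : ℕ} {χ θ : ℝ} (hχ : 0 ≤ χ) (h0 : 0 ≤ θ) (h1 : θ ≤ 1) (u v : Fin p → ℝ) :
    √(χ + ∑ i, (θ * u i + (1 - θ) * v i) ^ 2)
      ≤ θ * √(χ + ∑ i, u i ^ 2) + (1 - θ) * √(χ + ∑ i, v i ^ 2) := by
  set U := ∑ i, u i ^ 2
  set V := ∑ i, v i ^ 2
  set D := ∑ i, u i * v i
  have hU : 0 ≤ U := Finset.sum_nonneg fun i _ => sq_nonneg _
  have hV : 0 ≤ V := Finset.sum_nonneg fun i _ => sq_nonneg _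
  have hcs : D ^ 2 ≤ U * V := Finset.sum_mul_sq_le_sq_mul_sq _ _ _
  have e : ∑ i, (θ * u i + (1 - θ) * v i) ^ 2 = θ ^ 2 * U + 2 * θ * (1 - θ) * D + (1 - θ) ^ 2 * V := by
    simp only [U, V, D, Finset.mul_sum, ← Finset.sum_add_distrib]
    exact Finset.sum_congr rfl fun i _ => by ring
  rw [e]
  have hu := Real.sq_sqrt (add_nonneg hχ hU)
  have hv := Real.sq_sqrt (add_nonneg hχ hV)
  have hθ : 0 ≤ 1 - θ := by linarith
  apply Real.sqrt_le_iff.2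
  refine ⟨by positivity, ?_⟩
  have hD : χ + D ≤ √(χ + U) * √(χ + V) := by
    rw [← Real.sqrt_mul (by positivity)]
    apply Real.le_sqrt_of_sq_le
    have h2 : 2 * D ≤ U + V := by
      have : (2 * D) ^ 2 ≤ (U + V) ^ 2 := by nlinarith [sq_nonneg (U - V)]
      exact (abs_le_of_sq_le_sq' this (by positivity)).2
    nlinarith
  have h3 := mul_le_mul_of_nonneg_left hD (by positivity : 0 ≤ 2 * θ * (1 - θ))
  nlinarith

lemma gh_ofReal_iff {x y z θ : ℝ} (hx : 0 < x) (hy : 0 < y) (hz : 0 < z) :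
    ENNReal.ofReal x ^ θ * ENNReal.ofReal y ^ (1 - θ) ≤ ENNReal.ofReal z ↔
      θ * Real.log x + (1 - θ) * Real.log y ≤ Real.log z := by
  rw [ENNReal.ofReal_rpow_of_pos hx, ENNReal.ofReal_rpow_of_pos hy,
    ← ENNReal.ofReal_mul (by positivity), ENNReal.ofReal_le_ofReal_iff hz.le,
    ← Real.log_le_log_iff (by positivity) hz, Real.log_mul (by positivity) (by positivity),
    Real.log_rpow hx, Real.log_rpow hy]

lemma gh_integrand {p : ℕ} (u b : Fin p → ℝ) (lam χ ψ x : ℝ) (hx : 0 < x) :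
    (2 * π * x) ^ (-(p:ℝ)/2) *
        Real.exp (-(∑ i, (u i - x * b i) ^ 2) / (2 * x)) *
        (x ^ (lam - 1) * Real.exp (-(χ / x + ψ * x) / 2))
      = (2 * π) ^ (-(p:ℝ)/2) * Real.exp (∑ i, u i * b i) *
        ghW (ψ + ∑ i, b i ^ 2) (lam - p / 2) (χ + ∑ i, u i ^ 2) x := by
  have e : ∑ i, (u i - x * b i) ^ 2
      = ∑ i, u i ^ 2 - 2 * x * ∑ i, u i * b i + x ^ 2 * ∑ i, b i ^ 2 := by
    simp only [Finset.mul_sum, ← Finset.sum_add_distrib, ← Finset.sum_sub_distrib]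
    exact Finset.sum_congr rfl fun i _ => by ring
  rw [e]
  set U := ∑ i, u i ^ 2
  set V := ∑ i, b i ^ 2
  set D := ∑ i, u i * b i
  unfold ghW
  rw [Real.mul_rpow (by positivity) hx.le]
  have e1 : lam - p / 2 - 1 = (-(p:ℝ)/2) + (lam - 1) := by ring
  rw [e1, Real.rpow_add hx]
  have e2 : Real.exp (-(U - 2 * x * D + x ^ 2 * V) / (2 * x)) * Real.exp (-(χ / x + ψ * x) / 2)
      = Real.exp D * Real.exp (-(χ + U) / (2 * x) - (ψ + V) * x / 2) := by
    rw [← Real.exp_add, ← Real.exp_add]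
    congr 1
    field_simp
    ring
  calc _ = (2 * π) ^ (-(p:ℝ)/2) * x ^ (-(p:ℝ)/2) * x ^ (lam - 1) *
        (Real.exp (-(U - 2 * x * D + x ^ 2 * V) / (2 * x)) * Real.exp (-(χ / x + ψ * x) / 2)) := by
        ring
    _ = _ := by rw [e2]; ring

/-- Corollary 2(iii): the multivariate generalized hyperbolic density is log-concave
iff `λ ≥ (p+1)/2`. -/
theorem multivariate_generalized_hyperbolic_logConcave_iff
    (p : ℕ) (hp : 1 ≤ p)
    (μ β : Fin p → ℝ)
    (A : Matrix (Fin p) (Fin p) ℝ) (hA : IsUnit A.det)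
    (lam χ ψ : ℝ)
    (hlam_pos : 0 < lam → 0 ≤ χ ∧ 0 < ψ)
    (hlam_zero : lam = 0 → 0 < χ ∧ 0 < ψ)
    (hlam_neg : lam < 0 → 0 < χ ∧ 0 ≤ ψ)
    (f : (Fin p → ℝ) → ℝ≥0∞)
    (hf : ∀ y, f y = ENNReal.ofReal |A.det|⁻¹ * ∫⁻ x in Ioi (0:ℝ), ENNReal.ofReal
      ((2 * π * x) ^ (-(p:ℝ)/2) *
        Real.exp (-(∑ i, (A⁻¹.mulVec (y - μ - x • β) i) ^ 2) / (2 * x)) *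
        (x ^ (lam - 1) * Real.exp (-(χ / x + ψ * x) / 2)))) :
    (∀ y₁ y₂ : Fin p → ℝ, ∀ θ ∈ Ioo (0:ℝ) 1,
        f y₁ ^ θ * f y₂ ^ (1 - θ) ≤ f (θ • y₁ + (1 - θ) • y₂)) ↔
      ((p:ℝ) + 1)/2 ≤ lam := by
  have hdet : 0 < |A.det|⁻¹ := inv_pos.2 (abs_pos.2 hA.ne_zero)
  set b : Fin p → ℝ := A⁻¹.mulVec β with hb
  set c : ℝ := ψ + ∑ i, b i ^ 2 with hc
  set ν : ℝ := lam - p / 2 with hν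
  set C : ℝ := |A.det|⁻¹ * (2 * π) ^ (-(p:ℝ)/2) with hC
  have hCp : 0 < C := by positivity
  have hV : 0 ≤ ∑ i, b i ^ 2 := Finset.sum_nonneg fun i _ => sq_nonneg _
  have hχ : 0 ≤ χ := by
    rcases lt_trichotomy lam 0 with h | h | h
    · exact (hlam_neg h).1.le
    · exact (hlam_zero h).1.le
    · exact (hlam_pos h).1
  have hP : ghP c ν := by
    rcases lt_trichotomy lam 0 with h | h | h
    · have h1 := (hlam_neg h).2
      rcases (add_nonneg h1 hV).eq_or_lt with h2 | h2
      · refine Or.inr ⟨h2.symm, ?_⟩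
        have : (0:ℝ) ≤ p := Nat.cast_nonneg p
        rw [hν]; linarith
      · exact Or.inl h2
    · exact Or.inl (by have := (hlam_zero h).2; linarith)
    · exact Or.inl (by have := (hlam_pos h).2; linarith)
  have hfv : ∀ (y u : Fin p → ℝ), u = A⁻¹.mulVec (y - μ) →
      IntegrableOn (ghW c ν (χ + ∑ i, u i ^ 2)) (Ioi 0) →
      f y = ENNReal.ofReal (C * Real.exp (∑ i, u i * b i) * ghH c ν (χ + ∑ i, u i ^ 2)) := by
    intro y u hu hi
    have h1 : ∀ x ∈ Ioi (0:ℝ), ENNReal.ofReal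
      ((2 * π * x) ^ (-(p:ℝ)/2) *
        Real.exp (-(∑ i, (A⁻¹.mulVec (y - μ - x • β) i) ^ 2) / (2 * x)) *
        (x ^ (lam - 1) * Real.exp (-(χ / x + ψ * x) / 2))) =
        ENNReal.ofReal ((2 * π) ^ (-(p:ℝ)/2) * Real.exp (∑ i, u i * b i) *
          ghW c ν (χ + ∑ i, u i ^ 2) x) := by
      intro x hx
      rw [← gh_integrand u b lam χ ψ x hx]
      have : ∀ i, A⁻¹.mulVec (y - μ - x • β) i = u i - x * b i := by
        intro i
        rw [Matrix.mulVec_sub, Matrix.mulVec_smul, ← hu, ← hb]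
        simp
      simp only [this]
    rw [hf y, setLIntegral_congr_fun measurableSet_Ioi h1,
      ← ofReal_integral_eq_lintegral_ofReal (hi.const_mul _), ← ENNReal.ofReal_mul hdet.le,
      integral_const_mul]
    · congr 1
      rw [hC]; unfold ghH; ring
    · filter_upwards [ae_restrict_mem measurableSet_Ioi] with x hx
      have := ghW_pos (c := c) (a := ν) (s := χ + ∑ i, u i ^ 2) hx
      simp only [Pi.zero_apply]
      positivity
  have hlog : ∀ D H : ℝ, 0 < H → Real.log (C * Real.exp D * H) = Real.log C + D + Real.log H := by
    intro D H hH
    rw [Real.log_mul (by positivity) hH.ne', Real.log_mul hCp.ne' (Real.exp_pos _).ne', Real.log_exp]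
  constructor
  · intro hlc
    have hconc : ConcaveOn ℝ (Ioi 0) (fun t => Real.log (ghH c ν (χ + t ^ 2))) := by
      let i0 : Fin p := ⟨0, hp⟩
      let Y : ℝ → (Fin p → ℝ) := fun t => μ + A.mulVec (Pi.single i0 t)
      have hY : ∀ t, Pi.single i0 t = A⁻¹.mulVec (Y t - μ) := by
        intro t
        simp only [Y]
        rw [add_sub_cancel_left, Matrix.mulVec_mulVec, Matrix.nonsing_inv_mul A hA, Matrix.one_mulVec]
      have hs1 : ∀ t : ℝ, ∑ i, (Pi.single i0 t : Fin p → ℝ) i ^ 2 = t ^ 2 := by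
        intro t
        rw [Finset.sum_eq_single i0] <;> simp +contextual [Pi.single_apply]
      have hs2 : ∀ t : ℝ, ∑ i, (Pi.single i0 t : Fin p → ℝ) i * b i = t * b i0 := by
        intro t
        rw [Finset.sum_eq_single i0] <;> simp +contextual [Pi.single_apply]
      have hv : ∀ t, 0 < t → f (Y t)
          = ENNReal.ofReal (C * Real.exp (t * b i0) * ghH c ν (χ + t ^ 2)) := by
        intro t ht
        have := hfv (Y t) (Pi.single i0 t) (hY t)
        rw [hs1, hs2] at this
        exact this (ghW_int hP (by positivity))
      have hHp : ∀ t, 0 < t → 0 < ghH c ν (χ + t ^ 2) := fun t ht => ghH_pos hP (by positivity)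
      rw [concaveOn_iff_forall_pos]
      refine ⟨convex_Ioi 0, ?_⟩
      intro x hx y hy θ η hθ hη hsum
      obtain rfl : η = 1 - θ := by linarith
      have hx' : 0 < x := hx
      have hy' : 0 < y := hy
      have hz : 0 < θ * x + (1 - θ) * y := by positivity
      have h1 := hlc (Y x) (Y y) θ ⟨hθ, by linarith⟩
      have hYc : θ • Y x + (1 - θ) • Y y = Y (θ * x + (1 - θ) * y) := by
        have e : (Pi.single i0 (θ * x + (1 - θ) * y) : Fin p → ℝ)
            = θ • Pi.single i0 x + (1 - θ) • Pi.single i0 y := by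
          rw [← Pi.single_smul, ← Pi.single_smul, ← Pi.single_add]; rfl
        simp only [Y]
        rw [e, Matrix.mulVec_add, Matrix.mulVec_smul, Matrix.mulVec_smul]
        module
      have p1 := hHp x hx'
      have p2 := hHp y hy'
      have p3 := hHp _ hz
      rw [hYc, hv x hx', hv y hy', hv _ hz, gh_ofReal_iff (by positivity) (by positivity)
        (by positivity), hlog _ _ p1, hlog _ _ p2, hlog _ _ p3] at h1
      simp only [smul_eq_mul]
      linarith
    have := gh_converse hP hχ hconc
    rw [hν] at this
    linarith
  · intro hl
    have hp0 : (0:ℝ) ≤ p := Nat.cast_nonneg p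
    have hν2 : 1 / 2 ≤ ν := by rw [hν]; linarith
    have hc0 : 0 < c := by
      have := (hlam_pos (by linarith)).2
      rw [hc]; linarith
    intro y₁ y₂ θ hθ
    obtain ⟨u, hu⟩ : ∃ u, u = A⁻¹.mulVec (y₁ - μ) := ⟨_, rfl⟩
    obtain ⟨v, hv⟩ : ∃ v, v = A⁻¹.mulVec (y₂ - μ) := ⟨_, rfl⟩
    have hw : θ • u + (1 - θ) • v = A⁻¹.mulVec (θ • y₁ + (1 - θ) • y₂ - μ) := by
      rw [hu, hv, ← Matrix.mulVec_smul, ← Matrix.mulVec_smul, ← Matrix.mulVec_add]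
      congr 1
      module
    have hnn : ∀ u : Fin p → ℝ, 0 ≤ χ + ∑ i, u i ^ 2 := fun u =>
      add_nonneg hχ (Finset.sum_nonneg fun i _ => sq_nonneg _)
    have hint : ∀ s, 0 ≤ s → IntegrableOn (ghW c ν s) (Ioi 0) := fun s hs =>
      gh_int_all hc0 (by linarith) hs
    have hHp : ∀ s, 0 ≤ s → 0 < ghH c ν s := fun s hs => ghH_pos_of (hint s hs)
    have p1 := hHp _ (hnn u)
    have p2 := hHp _ (hnn v)
    have p3 := hHp _ (hnn (θ • u + (1 - θ) • v))
    rw [hfv y₁ u hu (hint _ (hnn u)), hfv y₂ v hv (hint _ (hnn v)), hfv _ _ hw (hint _ (hnn _)),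
      gh_ofReal_iff (by positivity) (by positivity) (by positivity),
      hlog _ _ p1, hlog _ _ p2, hlog _ _ p3]
    have hD : ∑ i, (θ • u + (1 - θ) • v) i * b i
        = θ * ∑ i, u i * b i + (1 - θ) * ∑ i, v i * b i := by
      simp only [Finset.mul_sum, ← Finset.sum_add_distrib]
      exact Finset.sum_congr rfl fun i _ => by
        simp only [Pi.add_apply, Pi.smul_apply, smul_eq_mul]; ring
    rw [hD]
    have hsq := gh_sqrt_convex hχ hθ.1.le hθ.2.le u v
    have hθ1 : 0 ≤ 1 - θ := by linarith [hθ.2]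
    have hcc := (gh_concave hc0 hν2).2 (mem_Ici.2 (Real.sqrt_nonneg (χ + ∑ i, u i ^ 2)))
      (mem_Ici.2 (Real.sqrt_nonneg (χ + ∑ i, v i ^ 2))) hθ.1.le hθ1 (by ring)
    simp only [smul_eq_mul, zero_add] at hcc
    rw [Real.sq_sqrt (hnn u), Real.sq_sqrt (hnn v)] at hcc
    have hfin : Real.log (ghH c ν ((θ * √(χ + ∑ i, u i ^ 2) + (1 - θ) * √(χ + ∑ i, v i ^ 2)) ^ 2))
        ≤ Real.log (ghH c ν (χ + ∑ i, (θ • u + (1 - θ) • v) i ^ 2)) := by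
      apply Real.log_le_log (hHp _ (sq_nonneg _))
      apply ghH_anti (hint _ (hnn _)) (hint _ (sq_nonneg _))
      rw [← Real.sqrt_le_left (add_nonneg (mul_nonneg hθ.1.le (Real.sqrt_nonneg _))
        (mul_nonneg hθ1 (Real.sqrt_nonneg _)))]
      exact hsq
    linarith
end

section
/- Let g be a nonnegative Lebesgue-integrable function on ℝ supported on (0,∞) with 0 < ∫₀^∞ g(x) dx < ∞, and define the Poisson mixture sequence f : ℕ → ℝ by f(n) = ∫₀^∞ e^{−x} xⁿ / n! · g(x) dx. If g is unimodal on (0,∞), then f is a unimodal sequence: there exists m ∈ ℕ such that f(k) ≤ f(k+1) for all k < m and f(k+1) ≤ f(k) for all k ≥ m. -/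
open MeasureTheory Set Real

lemma pm_int_pow (j : ℕ) : IntegrableOn (fun x : ℝ => Real.exp (-x) * x ^ j) (Ioi 0) := by
  have h := Real.GammaIntegral_convergent (s := (j:ℝ) + 1) (by positivity)
  refine h.congr_fun (fun x hx => ?_) measurableSet_Ioi
  simp

lemma pm_bound (j : ℕ) (x : ℝ) (hx : 0 ≤ x) :
    Real.exp (-x) * x ^ j / (Nat.factorial j : ℝ) ≤ 1 := by
  have h := Real.pow_div_factorial_le_exp x hx j
  have h2 : Real.exp (-x) * Real.exp x = 1 := by rw [← Real.exp_add]; simp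
  calc _ = Real.exp (-x) * (x ^ j / (Nat.factorial j : ℝ)) := by ring
    _ ≤ Real.exp (-x) * Real.exp x := by gcongr
    _ = 1 := h2

lemma pm_int_g (g : ℝ → ℝ) (hg_int : IntegrableOn g (Ioi 0)) (j : ℕ) :
    IntegrableOn (fun x : ℝ => Real.exp (-x) * x ^ j / (Nat.factorial j : ℝ) * g x) (Ioi 0) := by
  refine Integrable.bdd_mul (c := 1) hg_int (by fun_prop) ?_
  filter_upwards [ae_restrict_mem measurableSet_Ioi] with x hx
  have hx : 0 < x := hx
  rw [Real.norm_of_nonneg (by positivity)]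
  exact pm_bound j x hx.le

lemma pm_deriv (k : ℕ) (x₀ x : ℝ) : HasDerivAt (fun x : ℝ => (x - x₀) * (Real.exp (-x) * x ^ (k+1)))
    (Real.exp (-x) * x ^ k * (-x^2 + (k+2+x₀) * x - (k+1)*x₀)) x := by
  have h1 := (hasDerivAt_id x).sub_const x₀
  have h2 := (hasDerivAt_neg x).exp
  have h3 := hasDerivAt_pow (k+1) x
  refine (h1.mul (h2.mul h3)).congr_deriv ?_
  simp
  ring

lemma pm_int_H (k : ℕ) (x₀ : ℝ) : IntegrableOn
    (fun x : ℝ => Real.exp (-x) * x ^ k * (-x^2 + (k+2+x₀) * x - (k+1)*x₀)) (Ioi 0) := by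
  have h := (((pm_int_pow (k+2)).neg).add ((pm_int_pow (k+1)).const_mul (k+2+x₀))).sub
    ((pm_int_pow k).const_mul ((k+1)*x₀))
  refine h.congr_fun (fun x hx => ?_) measurableSet_Ioi
  simp
  ring

lemma pm_H1 (k : ℕ) (x₀ : ℝ) (h0 : 0 < x₀) : ∫ x in Ioc 0 x₀,
    (Real.exp (-x) * x ^ k * (-x^2 + (k+2+x₀) * x - (k+1)*x₀)) = 0 := by
  rw [← intervalIntegral.integral_of_le h0.le,
    intervalIntegral.integral_eq_sub_of_hasDerivAt (fun x _ => pm_deriv k x₀ x)]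
  · simp
  · apply Continuous.intervalIntegrable
    fun_prop

lemma pm_H2 (k : ℕ) (x₀ : ℝ) (h0 : 0 < x₀) : ∫ x in Ioi x₀,
    (Real.exp (-x) * x ^ k * (-x^2 + (k+2+x₀) * x - (k+1)*x₀)) = 0 := by
  rw [integral_Ioi_of_hasDerivAt_of_tendsto' (m := 0) (fun x _ => pm_deriv k x₀ x)]
  · simp
  · exact (pm_int_H k x₀).mono_set (Ioi_subset_Ioi h0.le)
  · have h := (Real.tendsto_pow_mul_exp_neg_atTop_nhds_zero (k+2)).sub
      ((Real.tendsto_pow_mul_exp_neg_atTop_nhds_zero (k+1)).const_mul x₀)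
    simp only [mul_zero, sub_zero] at h
    refine h.congr (fun x => ?_)
    ring

lemma pm_roots (k : ℕ) (x₀ : ℝ) (h0 : 0 < x₀) : ∃ c d : ℝ, 0 < c ∧ c < x₀ ∧ x₀ < d ∧
    ∀ x : ℝ, -x^2 + (k+2+x₀) * x - (k+1)*x₀ = (x - c) * (d - x) := by
  have hk : (0:ℝ) ≤ k := k.cast_nonneg
  obtain ⟨c, hc, hq⟩ : (0:ℝ) ∈ (fun x : ℝ => -x^2 + (k+2+x₀) * x - (k+1)*x₀) '' Ioo 0 x₀ := by
    apply intermediate_value_Ioo h0.le (by fun_prop)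
    constructor <;> simp <;> nlinarith
  simp only at hq
  refine ⟨c, k+2+x₀-c, hc.1, hc.2, ?_, fun x => by linarith⟩
  have h1 : (x₀ - c) * ((k+2+x₀-c) - x₀) = x₀ := by linarith
  have := hc.2
  by_contra! hcon
  nlinarith

lemma pm_key (g : ℝ → ℝ) (hg_int : IntegrableOn g (Ioi 0)) (x₀ : ℝ) (h0 : 0 < x₀)
    (hm : MonotoneOn g (Ioi 0 ∩ Iic x₀)) (ha : AntitoneOn g (Ioi 0 ∩ Ici x₀)) (k : ℕ)
    (hi : IntegrableOn (fun x : ℝ =>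
      (Real.exp (-x) * x ^ k * (-x^2 + (k+2+x₀) * x - (k+1)*x₀)) * g x) (Ioi 0)) :
    0 ≤ ∫ x in Ioi 0, (Real.exp (-x) * x ^ k * (-x^2 + (k+2+x₀) * x - (k+1)*x₀)) * g x := by
  obtain ⟨c, d, hc0, hc, hd, hq⟩ := pm_roots k x₀ h0
  have hs1 : Ioc 0 x₀ ⊆ Ioi (0:ℝ) := Ioc_subset_Ioi_self
  have hs2 : Ioi x₀ ⊆ Ioi (0:ℝ) := Ioi_subset_Ioi h0.le
  rw [← Ioc_union_Ioi_eq_Ioi h0.le, setIntegral_union Ioc_disjoint_Ioi_same measurableSet_Ioi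
    (hi.mono_set hs1) (hi.mono_set hs2)]
  apply add_nonneg
  · calc (0:ℝ) = ∫ x in Ioc 0 x₀,
        (Real.exp (-x) * x ^ k * (-x^2 + (k+2+x₀) * x - (k+1)*x₀)) * g c := by
          rw [integral_mul_const, pm_H1 k x₀ h0, zero_mul]
      _ ≤ _ := by
        refine setIntegral_mono_on (((pm_int_H k x₀).mono_set hs1).mul_const _)
          (hi.mono_set hs1) measurableSet_Ioc (fun x hx => ?_)
        rw [hq, mul_assoc (Real.exp (-x) * x ^ k), mul_assoc (Real.exp (-x) * x ^ k)]
        have hx0 : 0 < x := hx.1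
        have hp : 0 ≤ Real.exp (-x) * x ^ k := by positivity
        refine mul_le_mul_of_nonneg_left ?_ hp
        have hdx : 0 ≤ d - x := by linarith [hx.2]
        rcases le_total x c with h | h
        · have := hm ⟨hx.1, hx.2⟩ ⟨hc0, hc.le⟩ h
          nlinarith [mul_nonneg (mul_nonneg (sub_nonneg.2 h) hdx) (sub_nonneg.2 this)]
        · have := hm ⟨hc0, hc.le⟩ ⟨hx.1, hx.2⟩ h
          nlinarith [mul_nonneg (mul_nonneg (sub_nonneg.2 h) hdx) (sub_nonneg.2 this)]
  · calc (0:ℝ) = ∫ x in Ioi x₀,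
        (Real.exp (-x) * x ^ k * (-x^2 + (k+2+x₀) * x - (k+1)*x₀)) * g d := by
          rw [integral_mul_const, pm_H2 k x₀ h0, zero_mul]
      _ ≤ _ := by
        refine setIntegral_mono_on (((pm_int_H k x₀).mono_set hs2).mul_const _)
          (hi.mono_set hs2) measurableSet_Ioi (fun x hx => ?_)
        rw [hq, mul_assoc (Real.exp (-x) * x ^ k), mul_assoc (Real.exp (-x) * x ^ k)]
        have hx1 : x₀ < x := hx
        have hx0 : 0 < x := h0.trans hx1
        have hd0 : 0 < d := h0.trans hd
        have hp : 0 ≤ Real.exp (-x) * x ^ k := by positivity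
        refine mul_le_mul_of_nonneg_left ?_ hp
        have hdx : 0 ≤ x - c := by linarith
        rcases le_total x d with h | h
        · have := ha ⟨hx0, hx1.le⟩ ⟨hd0, hd.le⟩ h
          nlinarith [mul_nonneg (mul_nonneg (sub_nonneg.2 h) hdx) (sub_nonneg.2 this)]
        · have := ha ⟨hd0, hd.le⟩ ⟨hx0, hx1.le⟩ h
          nlinarith [mul_nonneg (mul_nonneg (sub_nonneg.2 h) hdx) (sub_nonneg.2 this)]

/-- Theorem 3 (unimodality part, Holgate): if the mixing density `g` is unimodal on
`(0, ∞)`, then the Poisson mixture mass function `f` is a unimodal sequence. -/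
theorem poisson_mixture_unimodal
    (g : ℝ → ℝ) (hg_meas : Measurable g) (hg_nonneg : ∀ x, 0 ≤ g x)
    (hg_supp : ∀ x ≤ 0, g x = 0)
    (hg_int : IntegrableOn g (Ioi 0))
    (hg_pos : 0 < ∫ x in Ioi (0:ℝ), g x)
    (f : ℕ → ℝ)
    (hf : ∀ n, f n = ∫ x in Ioi (0:ℝ),
      Real.exp (-x) * x ^ n / (Nat.factorial n : ℝ) * g x)
    (hg_uni : ∃ x₀ ∈ Ioi (0:ℝ),
      MonotoneOn g (Ioi 0 ∩ Iic x₀) ∧ AntitoneOn g (Ioi 0 ∩ Ici x₀)) :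
    ∃ m : ℕ, (∀ k < m, f k ≤ f (k + 1)) ∧ (∀ k ≥ m, f (k + 1) ≤ f k) := by
  obtain ⟨x₀, h0, hm, ha⟩ := hg_uni
  have h0 : 0 < x₀ := h0
  have hI := pm_int_g g hg_int
  have hfn : ∀ n, 0 ≤ f n := by
    intro n
    rw [hf]
    refine setIntegral_nonneg measurableSet_Ioi (fun x hx => ?_)
    have hx : 0 < x := hx
    have := hg_nonneg x
    positivity
  have hstep : ∀ k : ℕ, (k+2 : ℝ) * (f (k+2) - f (k+1)) ≤ x₀ * (f (k+1) - f k) := by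
    intro k
    have e : (fun x : ℝ => (Real.exp (-x) * x ^ k * (-x^2 + (k+2+x₀) * x - (k+1)*x₀)) * g x)
      = fun x : ℝ =>
        (-((k+2:ℝ) * (Nat.factorial (k+1) : ℝ))) *
          (Real.exp (-x) * x ^ (k+2) / (Nat.factorial (k+2) : ℝ) * g x)
        + ((k+2+x₀) * (Nat.factorial (k+1) : ℝ)) *
          (Real.exp (-x) * x ^ (k+1) / (Nat.factorial (k+1) : ℝ) * g x)
        + (-(x₀ * (Nat.factorial (k+1) : ℝ))) *
          (Real.exp (-x) * x ^ k / (Nat.factorial k : ℝ) * g x) := by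
      funext x
      have h1 : (Nat.factorial k : ℝ) ≠ 0 := by positivity
      have h2 : (k + 1 : ℝ) ≠ 0 := by positivity
      have h3 : (k + 2 : ℝ) ≠ 0 := by positivity
      have e2 : (Nat.factorial (k+2) : ℝ) = (k+2) * ((k+1) * Nat.factorial k) := by
        rw [Nat.factorial_succ, Nat.factorial_succ]; push_cast; ring
      have e1 : (Nat.factorial (k+1) : ℝ) = (k+1) * Nat.factorial k := by
        rw [Nat.factorial_succ]; push_cast; ring
      rw [e2, e1]
      field_simp
      ring
    have i2 := (hI (k+2)).const_mul (-((k+2:ℝ) * (Nat.factorial (k+1) : ℝ)))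
    have i1 := (hI (k+1)).const_mul ((k+2+x₀) * (Nat.factorial (k+1) : ℝ))
    have i0 := (hI k).const_mul (-(x₀ * (Nat.factorial (k+1) : ℝ)))
    have key := pm_key g hg_int x₀ h0 hm ha k (by rw [e]; exact (i2.add i1).add i0)
    rw [e, integral_add (by exact i2.add i1) i0, integral_add i2 i1, integral_const_mul,
      integral_const_mul, integral_const_mul, ← hf, ← hf, ← hf] at key
    have hp : (0:ℝ) < Nat.factorial (k+1) := by positivity
    have : 0 ≤ (Nat.factorial (k+1) : ℝ) *
        (x₀ * (f (k+1) - f k) - (k+2 : ℝ) * (f (k+2) - f (k+1))) := by linarith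
    linarith [nonneg_of_mul_nonneg_right this hp]
  have hlim : Filter.Tendsto f Filter.atTop (nhds 0) := by
    have : Filter.Tendsto (fun n : ℕ => ∫ x in Ioi (0:ℝ),
        Real.exp (-x) * x ^ n / (Nat.factorial n : ℝ) * g x) Filter.atTop
        (nhds (∫ x in Ioi (0:ℝ), (0:ℝ))) := by
      refine tendsto_integral_of_dominated_convergence g
        (fun n => (hI n).aestronglyMeasurable) hg_int ?_ ?_
      · intro n
        filter_upwards [ae_restrict_mem measurableSet_Ioi] with x hx
        have hx : 0 < x := hx
        have hg := hg_nonneg x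
        rw [Real.norm_of_nonneg (by positivity)]
        exact mul_le_of_le_one_left hg (pm_bound n x hx.le)
      · refine Filter.Eventually.of_forall (fun x => ?_)
        have h := ((FloorSemiring.tendsto_pow_div_factorial_atTop x).const_mul
          (Real.exp (-x))).mul_const (g x)
        simp only [mul_zero, zero_mul] at h
        refine h.congr (fun n => ?_)
        ring
    simp only [integral_zero] at this
    exact this.congr (fun n => (hf n).symm)
  have hex : ∃ k, f (k+1) ≤ f k := by
    by_contra! hcon
    have hmono : StrictMono f := strictMono_nat_of_lt_succ hcon
    have := hmono.monotone.ge_of_tendsto hlim 1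
    linarith [hcon 0, hfn 0]
  classical
  refine ⟨Nat.find hex, fun k hk => (not_le.1 (Nat.find_min hex hk)).le, fun k hk => ?_⟩
  induction k, hk using Nat.le_induction with
  | base => exact Nat.find_spec hex
  | succ k hk ih =>
    have h := hstep k
    have h2 : (0:ℝ) < k + 2 := by positivity
    by_contra! hcon
    have hcon : f (k+1) < f (k+2) := hcon
    nlinarith [mul_pos h2 (sub_pos.2 hcon), mul_nonneg h0.le (sub_nonneg.2 ih)]
end

section
/- Let g be a nonnegative Lebesgue-integrable function on ℝ supported on (0,∞) with 0 < ∫₀^∞ g(x) dx < ∞, and define the Poisson mixture sequence f : ℕ → ℝ by f(n) = ∫₀^∞ e^{−x} xⁿ / n! · g(x) dx. If g restricted to (0,∞) is log-concave, then f is a log-concave sequence: f(n+1)² ≥ f(n)·f(n+2) for all n ∈ ℕ. -/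
open MeasureTheory Set Real

lemma pm_sign (d : ℝ → ℝ) (n : ℕ)
    (hS : ∀ x y z : ℝ, 0 < x → x < y → y < z → 0 ≤ d x → 0 ≤ d z → 0 ≤ d y)
    (hi : ∀ k : ℕ, IntegrableOn (fun x => x ^ k * d x) (Ioi 0))
    (h0 : ∫ x in Ioi (0:ℝ), x ^ n * d x = 0)
    (h2 : ∫ x in Ioi (0:ℝ), x ^ (n + 2) * d x = 0) :
    0 ≤ ∫ x in Ioi (0:ℝ), x ^ (n + 1) * d x := by
  -- quadratic test
  have key : ∀ α β : ℝ, 0 < α + β → (∀ x > 0, (x - α) * (x - β) * d x ≤ 0) →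
      0 ≤ ∫ x in Ioi (0:ℝ), x ^ (n + 1) * d x := by
    intro α β hab hx
    have e : ∫ x in Ioi (0:ℝ), (x ^ (n + 2) * d x - (α + β) * (x ^ (n + 1) * d x)
        + α * β * (x ^ n * d x)) ≤ 0 := by
      apply setIntegral_nonpos measurableSet_Ioi
      intro x hx0
      have hx0' : (0:ℝ) < x := hx0
      have : x ^ (n + 2) * d x - (α + β) * (x ^ (n + 1) * d x) + α * β * (x ^ n * d x)
        = x ^ n * ((x - α) * (x - β) * d x) := by ring
      rw [this]
      exact mul_nonpos_of_nonneg_of_nonpos (by positivity) (hx x hx0)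
    rw [integral_add, integral_sub, integral_const_mul, integral_const_mul, h0, h2] at e
    · nlinarith
    · exact hi _
    · exact (hi _).const_mul _
    · exact (hi _).sub ((hi _).const_mul _)
    · exact (hi _).const_mul _
  set S : Set ℝ := {x | 0 < x ∧ 0 ≤ d x} with hSdef
  by_cases hne : S.Nonempty
  swap
  · apply key 1 1 (by norm_num)
    intro x hx
    have : ¬ (0 ≤ d x) := fun h => hne ⟨x, hx, h⟩
    nlinarith [mul_self_nonneg (x - 1)]
  have hbb : BddBelow S := ⟨0, fun x hx => hx.1.le⟩
  have hα : 0 ≤ sInf S := le_csInf hne fun x hx => hx.1.le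
  have hlow : ∀ x > 0, x < sInf S → d x < 0 := by
    intro x hx hxa
    by_contra h
    exact absurd (csInf_le hbb ⟨hx, not_lt.1 h⟩) (not_le.2 hxa)
  by_cases hba : BddAbove S
  · have hup : ∀ x > 0, sSup S < x → d x < 0 := by
      intro x hx hxa
      by_contra h
      exact absurd (le_csSup hba ⟨hx, not_lt.1 h⟩) (not_le.2 hxa)
    have hβ : 0 < sSup S := by
      obtain ⟨x, hx⟩ := hne
      exact lt_of_lt_of_le hx.1 (le_csSup hba hx)
    have hαβ : sInf S ≤ sSup S := csInf_le_csSup hne hbb hba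
    apply key (sInf S) (sSup S) (by linarith)
    intro x hx
    rcases lt_trichotomy x (sInf S) with h | h | h
    · have := hlow x hx h
      have : 0 ≤ (x - sInf S) * (x - sSup S) := mul_nonneg_of_nonpos_of_nonpos (by linarith) (by linarith)
      nlinarith
    · simp [h]
    rcases lt_trichotomy x (sSup S) with h' | h' | h'
    · obtain ⟨u, hu, hux⟩ := exists_lt_of_csInf_lt hne h
      obtain ⟨v, hv, hvx⟩ := exists_lt_of_lt_csSup hne h'
      have := hS u x v hu.1 hux hvx hu.2 hv.2
      have : (x - sInf S) * (x - sSup S) ≤ 0 := mul_nonpos_of_nonneg_of_nonpos (by linarith) (by linarith)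
      nlinarith
    · simp [h']
    · have := hup x hx h'
      have : 0 ≤ (x - sInf S) * (x - sSup S) := mul_nonneg (by linarith) (by linarith)
      nlinarith
  · have hhigh : ∀ x, sInf S < x → 0 ≤ d x := by
      intro x hx
      obtain ⟨u, hu, hux⟩ := exists_lt_of_csInf_lt hne hx
      obtain ⟨v, hv, hvx⟩ := not_bddAbove_iff.1 hba x
      exact hS u x v hu.1 hux hvx hu.2 hv.2
    set α := sInf S
    have hint : IntegrableOn (fun x => x ^ (n + 2) * d x - α ^ 2 * (x ^ n * d x)) (Ioi 0) :=
      (hi _).sub ((hi _).const_mul _)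
    have hz : ∫ x in Ioi (0:ℝ), (x ^ (n + 2) * d x - α ^ 2 * (x ^ n * d x)) = 0 := by
      rw [integral_sub (hi _) ((hi _).const_mul _), integral_const_mul, h0, h2]; simp
    have hnn : 0 ≤ᵐ[volume.restrict (Ioi (0:ℝ))]
        (fun x => x ^ (n + 2) * d x - α ^ 2 * (x ^ n * d x)) := by
      filter_upwards [ae_restrict_mem measurableSet_Ioi] with x hx
      have hx0 : (0:ℝ) < x := hx
      have e : x ^ (n + 2) * d x - α ^ 2 * (x ^ n * d x)
        = x ^ n * (x + α) * ((x - α) * d x) := by ring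
      show 0 ≤ x ^ (n + 2) * d x - α ^ 2 * (x ^ n * d x)
      rw [e]
      apply mul_nonneg (by positivity)
      rcases lt_trichotomy x α with h | h | h
      · have := hlow x hx0 h
        exact mul_nonneg_of_nonpos_of_nonpos (by linarith) this.le
      · simp [h]
      · exact mul_nonneg (by linarith) (hhigh x h)
    have hae := (integral_eq_zero_iff_of_nonneg_ae hnn hint).1 hz
    have hne' : ∀ᵐ x ∂(volume.restrict (Ioi (0:ℝ))), x ≠ α :=
      ae_restrict_of_ae (Measure.ae_ne volume α)
    apply le_of_eq
    symm
    apply integral_eq_zero_of_ae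
    filter_upwards [hae, hne', ae_restrict_mem measurableSet_Ioi] with x h1 h2 hx
    have hx0 : (0:ℝ) < x := hx
    have e : x ^ n * (x + α) * (x - α) * d x = 0 := by
      have h1' : x ^ (n + 2) * d x - α ^ 2 * (x ^ n * d x) = 0 := h1
      rw [← h1']; ring
    have h3 : x ^ n * (x + α) * (x - α) ≠ 0 :=
      mul_ne_zero (by positivity) (sub_ne_zero.2 h2)
    have := (mul_eq_zero.1 e).resolve_left h3
    simp [this]

lemma pm_gamma (a : ℝ) (ha : 0 < a) (k : ℕ) :
    ∫ x in Ioi (0:ℝ), x ^ k * Real.exp (-(a * x)) = (k.factorial : ℝ) / a ^ (k + 1) := by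
  have h := Real.integral_rpow_mul_exp_neg_mul_Ioi (a := (k:ℝ) + 1) (r := a) (by positivity) ha
  rw [Real.Gamma_nat_eq_factorial] at h
  simp only [add_sub_cancel_right, Real.rpow_natCast] at h
  rw [h]
  have : ((k:ℝ) + 1) = ((k + 1 : ℕ) : ℝ) := by push_cast; ring
  rw [this, Real.rpow_natCast, one_div, inv_pow]
  field_simp

lemma pm_gamma_int (a : ℝ) (ha : 0 < a) (k : ℕ) :
    IntegrableOn (fun x : ℝ => x ^ k * Real.exp (-(a * x))) (Ioi 0) := by
  by_contra h
  have h1 := pm_gamma a ha k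
  rw [integral_undef h] at h1
  have : 0 < (k.factorial : ℝ) / a ^ (k + 1) := by positivity
  linarith

/-- Theorem 3 (log-concavity part): if the mixing density `g` is log-concave on
`(0, ∞)`, then the Poisson mixture mass function `f` is a log-concave sequence. -/
theorem poisson_mixture_logConcave
    (g : ℝ → ℝ) (hg_meas : Measurable g) (hg_nonneg : ∀ x, 0 ≤ g x)
    (hg_supp : ∀ x ≤ 0, g x = 0)
    (hg_int : IntegrableOn g (Ioi 0))
    (hg_pos : 0 < ∫ x in Ioi (0:ℝ), g x)
    (f : ℕ → ℝ)
    (hf : ∀ n, f n = ∫ x in Ioi (0:ℝ),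
      Real.exp (-x) * x ^ n / (Nat.factorial n : ℝ) * g x)
    (hg_lc : ∀ x₁ ∈ Ioi (0:ℝ), ∀ x₂ ∈ Ioi (0:ℝ), ∀ θ ∈ Ioo (0:ℝ) 1,
      g x₁ ^ θ * g x₂ ^ (1 - θ) ≤ g (θ * x₁ + (1 - θ) * x₂)) :
    ∀ n : ℕ, f n * f (n + 2) ≤ f (n + 1) ^ 2 := by
  intro n
  have hf0 : ∀ k, 0 ≤ f k := by
    intro k
    rw [hf]
    apply setIntegral_nonneg measurableSet_Ioi
    intro x hx
    have hx0 : (0:ℝ) < x := hx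
    have := hg_nonneg x
    positivity
  have hgi : ∀ k : ℕ, IntegrableOn (fun x => x ^ k * (Real.exp (-x) * g x)) (Ioi 0) := by
    intro k
    have hm : Measurable (fun x : ℝ => x ^ k * (Real.exp (-x) * g x)) := by fun_prop
    refine Integrable.mono' (hg_int.const_mul (k.factorial : ℝ)) hm.aestronglyMeasurable ?_
    filter_upwards [ae_restrict_mem measurableSet_Ioi] with x hx
    have hx0 : (0:ℝ) < x := hx
    have hg := hg_nonneg x
    rw [Real.norm_of_nonneg (by positivity)]
    have h1 := Real.pow_div_factorial_le_exp x hx0.le k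
    rw [div_le_iff₀ (by positivity)] at h1
    have h2 : x ^ k * Real.exp (-x) ≤ k.factorial := by
      rw [Real.exp_neg, ← div_eq_mul_inv, div_le_iff₀ (Real.exp_pos x)]
      linarith
    nlinarith
  have hfk : ∀ k : ℕ, ∫ x in Ioi (0:ℝ), x ^ k * (Real.exp (-x) * g x) = k.factorial * f k := by
    intro k
    rw [hf, ← integral_const_mul]
    congr 1
    ext x
    field_simp
  rcases (hf0 n).eq_or_lt with h | hn
  · rw [← h]; simp; positivity
  rcases (hf0 (n + 2)).eq_or_lt with h | hn2
  · rw [← h]; simp; positivity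
  set a := Real.sqrt (f n / f (n + 2)) with hadef
  have ha : 0 < a := Real.sqrt_pos.2 (by positivity)
  have ha2 : a ^ 2 * f (n + 2) = f n := by
    rw [hadef, Real.sq_sqrt (by positivity)]; field_simp
  set C := f n * a ^ (n + 1) with hC
  have hCpos : 0 < C := by positivity
  set d : ℝ → ℝ := fun x => Real.exp (-x) * g x - C * Real.exp (-(a * x)) with hd
  have hsplit : ∀ k : ℕ, (fun x : ℝ => x ^ k * d x) = fun x =>
      x ^ k * (Real.exp (-x) * g x) - C * (x ^ k * Real.exp (-(a * x))) := by
    intro k; ext x; simp only [hd]; ring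
  have hdi : ∀ k : ℕ, IntegrableOn (fun x => x ^ k * d x) (Ioi 0) := by
    intro k
    rw [hsplit]
    exact (hgi k).sub ((pm_gamma_int a ha k).const_mul C)
  have hD : ∀ k : ℕ, ∫ x in Ioi (0:ℝ), x ^ k * d x
      = k.factorial * (f k - C / a ^ (k + 1)) := by
    intro k
    rw [hsplit, integral_sub (hgi k) ((pm_gamma_int a ha k).const_mul C), integral_const_mul,
      pm_gamma a ha, hfk]
    ring
  have hdsign : ∀ x, 0 ≤ d x ↔ C * Real.exp ((1 - a) * x) ≤ g x := by
    intro x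
    have : d x = Real.exp (-x) * (g x - C * Real.exp ((1 - a) * x)) := by
      have : Real.exp (-(a * x)) = Real.exp (-x) * Real.exp ((1 - a) * x) := by
        rw [← Real.exp_add]; ring_nf
      simp only [hd, this]; ring
    rw [this, mul_nonneg_iff_of_pos_left (Real.exp_pos _), sub_nonneg]
  have hmain := pm_sign d n ?_ hdi ?_ ?_
  · rw [hD] at hmain
    have h1 : 0 ≤ f (n + 1) - C / a ^ (n + 1 + 1) :=
      nonneg_of_mul_nonneg_right hmain (by positivity)
    have h2 : C / a ^ (n + 1 + 1) = a * f (n + 2) := by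
      rw [hC, ← ha2]; field_simp; ring
    rw [h2] at h1
    have h3 : 0 < a * f (n + 2) := by positivity
    rw [← ha2]
    nlinarith
  · intro x y z hx hxy hyz hdx hdz
    rw [hdsign] at *
    set θ := (z - y) / (z - x) with hθ
    have hzx : 0 < z - x := by linarith
    have hθ0 : 0 < θ := div_pos (by linarith) hzx
    have hθ1 : θ < 1 := by rw [hθ, div_lt_one hzx]; linarith
    have hy : θ * x + (1 - θ) * z = y := by
      rw [hθ]; field_simp; ring
    have h := hg_lc x hx z (show (0:ℝ) < z by linarith) θ ⟨hθ0, hθ1⟩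
    rw [hy] at h
    refine le_trans ?_ h
    calc C * Real.exp ((1 - a) * y)
        = (C * Real.exp ((1 - a) * x)) ^ θ * (C * Real.exp ((1 - a) * z)) ^ (1 - θ) := by
          rw [Real.mul_rpow hCpos.le (Real.exp_pos _).le,
            Real.mul_rpow hCpos.le (Real.exp_pos _).le, ← Real.exp_mul, ← Real.exp_mul,
            mul_mul_mul_comm, ← Real.rpow_add hCpos, ← Real.exp_add, ← hy]
          rw [show θ + (1 - θ) = 1 by ring, Real.rpow_one]
          ring_nf
      _ ≤ _ := by
          apply mul_le_mul
          · exact Real.rpow_le_rpow (by positivity) hdx hθ0.le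
          · exact Real.rpow_le_rpow (by positivity) hdz (by linarith)
          · positivity
          · exact Real.rpow_nonneg (hg_nonneg _) _
  · rw [hD, hC]; field_simp; simp
  · rw [hD, hC, ← ha2]; field_simp; ring
end
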